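/- Let q be a power of a prime p, k = F_q(t), and E = k(α) a geometric Artin-Schreier extension of k of degree p, where α^p − α = n for some n ∈ k, with Galois group generated by σ. Then for all sufficiently large N: the set T_1 of monic irreducible polynomials P of degree N (with ord_P(n) ≥ 0) whose Hasse symbol {n/P} equals 0 coincides with the set of unramified monic irreducible P of degree N with Artin symbol (P, E/k) equal to the identity, and #T_1 = (1/p)·q^N/N + O(q^{N/2}/N); and the set T_2 of monic irreducible P of degree N with {n/P} ≠ 0 coincides with the set of unramified monic irreducible P of degree N with (P, E/k) = σ^i for some i not divisible by p, and #T_2 = ((p−1)/p)·q^N/N + O(q^{N/2}/N). -/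

import Mathlib

open Polynomial Filter

/-- The Hasse symbol `{D/P} ∈ F_p` of `D ∈ F_q(t)` at a monic irreducible `P ∈ F_q[t]`
(meaningful when `ord_P(D) ≥ 0`, i.e. `P ∤ denom(D)`), defined as
`tr_{F_q/F_p}(tr_{(F_q[t]/(P))/F_q}(D mod P))`, where `D mod P` is computed as
`num(D)·denom(D)⁻¹` in `F_q[t]/(P)`. -/
noncomputable def hasseSymbol (p : ℕ) {Fq : Type} [Field Fq] [Fintype Fq]
    [Algebra (ZMod p) Fq] (P : Polynomial Fq) (D : RatFunc Fq) : ZMod p :=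
  Algebra.trace (ZMod p) Fq (Algebra.trace Fq (AdjoinRoot P)
    (AdjoinRoot.mk P D.num * Ring.inverse (AdjoinRoot.mk P D.denom)))

theorem exists_valuationSubring_root {K Ω : Type*} [Field K] [Field Ω] (φ : K[X] →+* Ω)
    (hφ : Function.Injective φ) (x₀ : K) :
    ∃ V : ValuationSubring Ω, V.valuation (φ (X - C x₀)) < 1 ∧
      ∀ f : K[X], f.eval x₀ ≠ 0 → V.valuation (φ f) = 1 := by
  set P : Ideal K[X] := RingHom.ker (evalRingHom x₀) with hP
  have hPp : P.IsPrime := RingHom.ker_isPrime _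
  have hmem : ∀ f : K[X], f ∈ P ↔ f.eval x₀ = 0 := fun f => by simp [hP, RingHom.mem_ker]
  have hu : ∀ y : P.primeCompl, IsUnit (φ y) := by
    rintro ⟨y, hy⟩
    refine isUnit_iff_ne_zero.2 fun h => hy ?_
    have h' : y = 0 := (map_eq_zero_iff φ hφ).1 h
    exact h' ▸ P.zero_mem
  let ψ : Localization.AtPrime P →+* Ω := IsLocalization.lift hu
  have hψ : ∀ f, ψ (algebraMap _ _ f) = φ f := fun f => IsLocalization.lift_eq hu f
  obtain ⟨V, h, hloc⟩ := IsLocalRing.exists_factor_valuationRing ψ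
  refine ⟨V, ?_, fun f hf => ?_⟩
  · rw [← hψ]
    have hn : ¬ IsUnit (algebraMap K[X] (Localization.AtPrime P) (X - C x₀)) := by
      rw [IsLocalization.AtPrime.isUnit_to_map_iff _ P]
      simp [Ideal.primeCompl, hmem]
    have h2 : ¬ IsUnit (ψ.codRestrict V.toSubring h (algebraMap _ _ (X - C x₀))) :=
      fun hh => hn (hloc.map_nonunit _ hh)
    exact (V.valuation_lt_one_iff ⟨_, h _⟩).1 ((IsLocalRing.mem_maximalIdeal _).2 h2)
  · rw [← hψ]
    have hn : IsUnit (algebraMap K[X] (Localization.AtPrime P) f) := by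
      rw [IsLocalization.AtPrime.isUnit_to_map_iff _ P]
      simpa [Ideal.primeCompl, hmem] using hf
    have h2 : IsUnit (ψ.codRestrict V.toSubring h (algebraMap _ _ f)) := hn.map _
    exact (V.valuation_eq_one_iff ⟨_, h _⟩).1 h2

theorem Valuation.sum_ne_zero_of_pow_eq {Ω Γ ι : Type*} [Field Ω]
    [LinearOrderedCommGroupWithZero Γ] (v : Valuation Ω Γ) {γ : Γ} (h0 : 0 < γ) (h1 : γ < 1)
    {p : ℕ} (hp : p ≠ 0) (s : Finset ι) (hs : s.Nonempty) (f : ι → Ω) (e : ι → ℕ)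
    (he : Set.InjOn e s) (hf : ∀ i ∈ s, v (f i) ^ p = γ ^ e i) : ∑ i ∈ s, f i ≠ 0 := by
  classical
  obtain ⟨j, hj, hmin⟩ := s.exists_min_image e hs
  have hlt : ∀ i ∈ s \ {j}, v (f i) < v (f j) := by
    intro i hi
    rw [Finset.mem_sdiff, Finset.mem_singleton] at hi
    refine lt_of_pow_lt_pow_left₀ p zero_le ?_
    rw [hf i hi.1, hf j hj]
    refine pow_lt_pow_right_of_lt_one₀ h0 h1 (lt_of_le_of_ne (hmin i hi.1) fun h => ?_)
    exact hi.2 (he hi.1 hj h.symm)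
  have hne : f j ≠ 0 := fun h => by
    have := hf j hj
    rw [h, map_zero, zero_pow hp] at this
    exact (pow_pos h0 _).ne this
  intro hsum
  have := v.map_sum_eq_of_lt hj hlt
  rw [hsum, map_zero] at this
  exact hne (v.zero_iff.1 this.symm)

/-- The monic integral equation `W ^ p - B ^ (p - 1) W - A B ^ (p - 1)` of `W = B y`, where
`y ^ p - y = A / B`. -/
noncomputable def asPoly {K : Type*} [Field K] (p : ℕ) (A B : K[X]) : K[X][X] :=
  X ^ p - (C (B ^ (p - 1)) * X + C (A * B ^ (p - 1)))

theorem asPoly_aux_degree {K : Type*} [Field K] {p : ℕ} (hp : 1 < p) (A B : K[X]) :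
    (C (B ^ (p - 1)) * X + C (A * B ^ (p - 1)) : K[X][X]).degree < (p : ℕ) :=
  lt_of_le_of_lt degree_linear_le (by exact_mod_cast hp)

theorem asPoly_monic {K : Type*} [Field K] {p : ℕ} (hp : 1 < p) (A B : K[X]) :
    (asPoly p A B).Monic :=
  monic_X_pow_sub (asPoly_aux_degree hp A B)

theorem asPoly_natDegree {K : Type*} [Field K] {p : ℕ} (hp : 1 < p) (A B : K[X]) :
    (asPoly p A B).natDegree = p := by
  rw [asPoly, natDegree_sub_eq_left_of_natDegree_lt, natDegree_X_pow]
  rw [natDegree_X_pow]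
  exact lt_of_le_of_lt natDegree_linear_le hp

theorem map_eq_pow_rootMultiplicity {K Ω Γ : Type*} [Field K] [Field Ω]
    [LinearOrderedCommGroupWithZero Γ] (v : Valuation Ω Γ) (φ : K[X] →+* Ω) (x₀ : K)
    (hv : ∀ f : K[X], f.eval x₀ ≠ 0 → v (φ f) = 1) {f : K[X]} (hf : f ≠ 0) :
    v (φ f) = v (φ (X - C x₀)) ^ f.rootMultiplicity x₀ := by
  obtain ⟨g, hg, hdvd⟩ := exists_eq_pow_rootMultiplicity_mul_and_not_dvd f hf x₀
  conv_lhs => rw [hg]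
  rw [map_mul, map_mul, map_pow, map_pow, hv g, mul_one]
  rwa [Ne, ← IsRoot.def, ← dvd_iff_isRoot]

theorem exponent_injective {p d R u u' v v' j j' r r' : ℕ} (hp : p.Prime) (hd : ¬ p ∣ d)
    (hR : p ∣ R) (hu : p * u < R) (hu' : p * u' < R) (hv : v < p) (hv' : v' < p) (hj : j < p)
    (hj' : j' < p)
    (h : p * (u + R * r) + d * (p - 1) * (v + R * j) =
      p * (u' + R * r') + d * (p - 1) * (v' + R * j')) : u = u' ∧ v = v' ∧ j = j' := by
  have hR0 : 0 < R := by omega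
  have hdp : p.Coprime (d * (p - 1)) := by
    refine (Nat.Prime.coprime_iff_not_dvd hp).2 fun hh => ?_
    rcases (Nat.Prime.dvd_mul hp).1 hh with h1 | h1
    · exact hd h1
    · have := Nat.le_of_dvd (by have := hp.two_le; omega) h1
      have := hp.two_le
      omega
  set D := d * (p - 1)
  have cancel : ∀ a b : ℕ, a < p → b < p → D * a ≡ D * b [MOD p] → a = b := fun a b ha hb hab =>
    Nat.ModEq.eq_of_lt_of_lt (Nat.ModEq.cancel_left_of_coprime hdp hab) ha hb
  have hv1 : v = v' := by
    refine cancel v v' hv hv' ?_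
    obtain ⟨R', rfl⟩ := hR
    have h1 : p * (u + p * R' * r + D * R' * j) + D * v =
        p * (u' + p * R' * r' + D * R' * j') + D * v' := by linarith
    have h2 := congrArg (· % p) h1
    simpa [Nat.ModEq, Nat.add_mod] using h2
  subst hv1
  have h1 : p * u + R * (p * r + D * j) = p * u' + R * (p * r' + D * j') := by linarith
  have h2 : p * u = p * u' := by
    have h2 := congrArg (· % R) h1
    simpa [Nat.mod_eq_of_lt hu, Nat.mod_eq_of_lt hu'] using h2
  have h3 : p * r + D * j = p * r' + D * j' := by
    refine Nat.eq_of_mul_eq_mul_left hR0 ?_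
    omega
  refine ⟨Nat.eq_of_mul_eq_mul_left hp.pos h2, rfl, cancel j j' hj hj' ?_⟩
  have h4 := congrArg (· % p) h3
  simpa [Nat.ModEq, Nat.add_mod] using h4

/-- The auxiliary functions of Stepanov's method do not vanish identically: at a totally ramified
pole all the terms have different valuations. -/
theorem asPoly_not_dvd_sum {K : Type*} [Field K] {p : ℕ} (hp : p.Prime) (A B : K[X]) (x₀ : K)
    (hA : A.eval x₀ ≠ 0) (hd : ¬ p ∣ B.rootMultiplicity x₀) {l R : ℕ} (hR : p ∣ R)
    (hl : p * l ≤ R) (c : Fin l × Fin p × Fin p → K[X]) (hc : c ≠ 0) :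
    ¬ asPoly p A B ∣ ∑ i, C ((X - C x₀) ^ (i.1 : ℕ) * c i ^ R) *
      (X ^ (i.2.1 : ℕ) * (X ^ R) ^ (i.2.2 : ℕ)) := by
  classical
  set φ : K[X] →+* AlgebraicClosure (RatFunc K) :=
    (algebraMap (RatFunc K) (AlgebraicClosure (RatFunc K))).comp (algebraMap K[X] (RatFunc K))
    with hφdef
  have hφ : Function.Injective φ :=
    (algebraMap (RatFunc K) _).injective.comp (RatFunc.algebraMap_injective K)
  obtain ⟨V, hγ1, hV⟩ := exists_valuationSubring_root φ hφ x₀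
  set v := V.valuation
  set γ := v (φ (X - C x₀)) with hγ
  have hγ0 : 0 < γ := by
    rw [zero_lt_iff, hγ, Ne, v.zero_iff, map_eq_zero_iff φ hφ]
    exact X_sub_C_ne_zero x₀
  have hval : ∀ f : K[X], f ≠ 0 → v (φ f) = γ ^ f.rootMultiplicity x₀ := fun f hf =>
    map_eq_pow_rootMultiplicity v φ x₀ hV hf
  have hB0 : B ≠ 0 := by
    rintro rfl
    simp at hd
  set d := B.rootMultiplicity x₀ with hddef
  have hd0 : d ≠ 0 := by
    intro h
    rw [h] at hd
    exact hd (dvd_zero p)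
  have hp2 := hp.two_le
  obtain ⟨ω, hω⟩ := IsAlgClosed.exists_root ((asPoly p A B).map φ) (by
    rw [degree_map_eq_of_injective hφ, degree_eq_natDegree (asPoly_monic hp.one_lt A B).ne_zero,
      asPoly_natDegree hp.one_lt]
    exact_mod_cast hp.ne_zero)
  have hω' : ω ^ p = φ B ^ (p - 1) * ω + φ A * φ B ^ (p - 1) := by
    have := hω
    simp only [asPoly, IsRoot.def, eval_map, eval₂_sub, eval₂_add, eval₂_mul, eval₂_C, eval₂_X,
      eval₂_pow, map_pow, map_mul, sub_eq_zero] at this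
    exact this
  have hvB : v (φ B ^ (p - 1)) = γ ^ (d * (p - 1)) := by
    rw [map_pow, hval B hB0, ← pow_mul]
  have hvAB : v (φ A * φ B ^ (p - 1)) = γ ^ (d * (p - 1)) := by
    rw [map_mul, hV A hA, hvB, one_mul]
  have hlt1 : γ ^ (d * (p - 1)) < 1 :=
    pow_lt_one₀ hγ0.le hγ1 (Nat.mul_ne_zero hd0 (by omega))
  have hω1 : v ω < 1 := by
    by_contra! h
    have h1 : v (φ B ^ (p - 1) * ω + φ A * φ B ^ (p - 1)) < v ω ^ p := by
      refine v.map_add_lt ?_ ?_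
      · rw [map_mul, hvB]
        calc γ ^ (d * (p - 1)) * v ω < 1 * v ω :=
              mul_lt_mul_of_pos_right hlt1 (lt_of_lt_of_le one_pos h)
          _ = v ω ^ 1 := by simp
          _ ≤ v ω ^ p := pow_le_pow_right₀ h hp.one_lt.le
      · rw [hvAB]
        exact lt_of_lt_of_le hlt1 (one_le_pow₀ h)
    rw [← hω', map_pow] at h1
    exact lt_irrefl _ h1
  have hωp : v ω ^ p = γ ^ (d * (p - 1)) := by
    rw [← map_pow, hω', v.map_add_eq_of_lt_right, hvAB]
    rw [hvAB, map_mul, hvB]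
    calc γ ^ (d * (p - 1)) * v ω < γ ^ (d * (p - 1)) * 1 :=
          mul_lt_mul_of_pos_left hω1 (pow_pos hγ0 _)
      _ = _ := mul_one _
  rintro ⟨Q, hQ⟩
  have hzero := congrArg (eval₂ φ ω) hQ
  rw [eval₂_mul, ← eval_map φ ω (p := asPoly p A B), hω.eq_zero, zero_mul, eval₂_finsetSum] at hzero
  set s : Finset (Fin l × Fin p × Fin p) := Finset.univ.filter fun i => c i ≠ 0 with hs
  have hRpos : ∀ i : Fin l, p * i < R := fun i =>
    lt_of_lt_of_le (Nat.mul_lt_mul_of_pos_left i.2 hp.pos) hl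
  refine Valuation.sum_ne_zero_of_pow_eq v hγ0 hγ1 hp.ne_zero s ?_
    (fun i => eval₂ φ ω (C ((X - C x₀) ^ (i.1 : ℕ) * c i ^ R) *
      (X ^ (i.2.1 : ℕ) * (X ^ R) ^ (i.2.2 : ℕ))))
    (fun i => p * (i.1 + R * (c i).rootMultiplicity x₀) + d * (p - 1) * (i.2.1 + R * i.2.2))
    ?_ ?_ ?_
  · obtain ⟨i, hi⟩ := Function.ne_iff.1 hc
    exact ⟨i, by simpa [hs] using hi⟩
  · rintro ⟨u, w, j⟩ - ⟨u', w', j'⟩ - h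
    obtain ⟨h1, h2, h3⟩ := exponent_injective hp hd hR (hRpos u) (hRpos u') w.2 w'.2 j.2 j'.2 h
    simp [Fin.ext_iff, h1, h2, h3]
  · rintro ⟨u, w, j⟩ hi
    have hci : c (u, w, j) ≠ 0 := by simpa [hs] using hi
    simp only [eval₂_mul, eval₂_C, eval₂_pow, eval₂_X, map_mul, map_pow]
    rw [← hγ, hval _ hci]
    calc _ = (γ ^ (p * (u + R * (c (u, w, j)).rootMultiplicity x₀))) *
          (v ω ^ p) ^ ((w : ℕ) + R * j) := by
          simp only [mul_pow, ← pow_mul, ← pow_add]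
          congr 2 <;> ring
      _ = _ := by rw [hωp, ← pow_mul, ← pow_add]
  · rw [← hzero, hs, Finset.sum_filter_of_ne]
    intro i _ h hci
    refine h ?_
    have hR0 : R ≠ 0 := by have := hRpos i.1; omega
    simp [hci, hR0]

/-- All coefficients of `F` have degree at most `δ`. -/
def CoeffDegLE {K : Type*} [Field K] (δ : ℕ) (F : K[X][X]) : Prop :=
  ∀ i, (F.coeff i).natDegree ≤ δ

namespace CoeffDegLE

variable {K : Type*} [Field K] {δ ε : ℕ} {F G : K[X][X]}

theorem mono (h : CoeffDegLE δ F) (hδ : δ ≤ ε) : CoeffDegLE ε F := fun i => (h i).trans hδ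

theorem add (hF : CoeffDegLE δ F) (hG : CoeffDegLE δ G) : CoeffDegLE δ (F + G) := fun i => by
  rw [coeff_add]
  exact natDegree_add_le_of_degree_le (hF i) (hG i)

theorem sum {ι : Type*} (s : Finset ι) (f : ι → K[X][X]) (h : ∀ i ∈ s, CoeffDegLE δ (f i)) :
    CoeffDegLE δ (∑ i ∈ s, f i) := fun j => by
  rw [finsetSum_coeff]
  exact natDegree_sum_le_of_forall_le s _ fun i hi => h i hi j

theorem mul (hF : CoeffDegLE δ F) (hG : CoeffDegLE ε G) : CoeffDegLE (δ + ε) (F * G) := fun i => by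
  rw [coeff_mul]
  exact natDegree_sum_le_of_forall_le _ _ fun x _ => natDegree_mul_le_of_le (hF _) (hG _)

theorem C_of_le {f : K[X]} (h : f.natDegree ≤ δ) : CoeffDegLE δ (C f : K[X][X]) := fun i => by
  rw [coeff_C]
  split_ifs
  · exact h
  · simp

theorem X : CoeffDegLE 0 (X : K[X][X]) := fun i => by
  rw [coeff_X]
  split_ifs <;> simp

theorem pow (hF : CoeffDegLE δ F) (n : ℕ) : CoeffDegLE (n * δ) (F ^ n) := by
  induction n with
  | zero =>
    rw [pow_zero, ← C_1]
    exact C_of_le (by simp)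
  | succ n ih =>
    rw [pow_succ]
    exact (ih.mul hF).mono (by rw [Nat.succ_mul])

theorem linear {f g : K[X]} (hf : f.natDegree ≤ δ) (hg : g.natDegree ≤ δ) :
    CoeffDegLE δ (C f * Polynomial.X + C g) :=
  ((C_of_le hf).mul X).add (C_of_le hg)

end CoeffDegLE

theorem exists_coeffDegLE_modByMonic {K : Type*} [Field K] (M : K[X][X]) (k : ℕ) :
    ∃ c₀, ∀ δ (F : K[X][X]), F.natDegree < k → CoeffDegLE δ F → CoeffDegLE (δ + c₀) (F %ₘ M) := by
  refine ⟨∑ i ∈ Finset.range k, ∑ j ∈ (X ^ i %ₘ M).support, ((X ^ i %ₘ M).coeff j).natDegree,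
    fun δ F hk hF => ?_⟩
  have h1 : ∀ i ∈ Finset.range k, CoeffDegLE (∑ i ∈ Finset.range k,
      ∑ j ∈ (X ^ i %ₘ M).support, ((X ^ i %ₘ M).coeff j).natDegree) (X ^ i %ₘ M) := by
    intro i hi j
    by_cases hj : j ∈ (X ^ i %ₘ M).support
    · exact (Finset.single_le_sum (f := fun j => ((X ^ i %ₘ M).coeff j).natDegree)
        (fun _ _ => Nat.zero_le _) hj).trans
        (Finset.single_le_sum (f := fun i => ∑ j ∈ (X ^ i %ₘ M).support,
          ((X ^ i %ₘ M).coeff j).natDegree) (fun _ _ => Nat.zero_le _) hi)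
    · rw [notMem_support_iff.1 hj]
      simp
  have h2 : F %ₘ M = ∑ i ∈ Finset.range k, C (F.coeff i) * (X ^ i %ₘ M) := by
    conv_lhs => rw [F.as_sum_range' k hk]
    simp only [← modByMonicHom_apply, map_sum, ← C_mul_X_pow_eq_monomial, ← smul_eq_C_mul,
      map_smul]
  rw [h2]
  exact CoeffDegLE.sum _ _ fun i hi => (CoeffDegLE.C_of_le (hF i)).mul (h1 i hi)

theorem asPoly_exists_linear_of_pow {K : Type*} [Field K] {p : ℕ} [Fact p.Prime] [CharP K p]
    (A B : K[X]) :
    ∃ D, ∀ k, ∃ b₁ b₀ : K[X], b₁.natDegree ≤ D * p ^ k ∧ b₀.natDegree ≤ D * p ^ k ∧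
      asPoly p A B ∣ X ^ p ^ k - (C b₁ * X + C b₀) := by
  have hp : p.Prime := Fact.out
  set D := (B ^ (p - 1)).natDegree + (A * B ^ (p - 1)).natDegree
  suffices h : ∀ k, ∃ b₁ b₀ : K[X], b₁.natDegree + D ≤ D * p ^ k ∧ b₀.natDegree + D ≤ D * p ^ k ∧
      asPoly p A B ∣ X ^ p ^ k - (C b₁ * X + C b₀) by
    refine ⟨D, fun k => ?_⟩
    obtain ⟨b₁, b₀, h1, h0, h⟩ := h k
    exact ⟨b₁, b₀, by omega, by omega, h⟩
  intro k
  induction k with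
  | zero => exact ⟨1, 0, by simp, by simp, by simp⟩
  | succ k ih =>
    obtain ⟨b₁, b₀, h1, h0, h⟩ := ih
    have hstep : ∀ a, a + D ≤ D * p ^ k → p * a + D + D ≤ D * p ^ (k + 1) := by
      intro a ha
      have := Nat.mul_le_mul_left p ha
      have h2 : 2 * D ≤ p * D := Nat.mul_le_mul_right D hp.two_le
      rw [pow_succ]
      nlinarith
    refine ⟨b₁ ^ p * B ^ (p - 1), b₁ ^ p * (A * B ^ (p - 1)) + b₀ ^ p, ?_, ?_, ?_⟩
    · have h2 := hstep _ h1
      have h3 : (b₁ ^ p * B ^ (p - 1)).natDegree ≤ p * b₁.natDegree + D :=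
        natDegree_mul_le_of_le natDegree_pow_le (Nat.le_add_right _ _)
      omega
    · have h2 := hstep _ h1
      have h2' := hstep _ h0
      have h3 : (b₁ ^ p * (A * B ^ (p - 1))).natDegree ≤ p * b₁.natDegree + D :=
        natDegree_mul_le_of_le natDegree_pow_le (Nat.le_add_left _ _)
      have h4 : (b₀ ^ p).natDegree ≤ p * b₀.natDegree := natDegree_pow_le
      have h5 := natDegree_add_le (b₁ ^ p * (A * B ^ (p - 1))) (b₀ ^ p)
      rcases max_cases (b₁ ^ p * (A * B ^ (p - 1))).natDegree (b₀ ^ p).natDegree with h6 | h6 <;>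
        omega
    · have h2 : X ^ p ^ (k + 1) - (C (b₁ ^ p * B ^ (p - 1)) * X +
          C (b₁ ^ p * (A * B ^ (p - 1)) + b₀ ^ p)) =
          (X ^ p ^ k - (C b₁ * X + C b₀)) ^ p + C (b₁ ^ p) * asPoly p A B := by
        rw [sub_pow_char, add_pow_char, asPoly, pow_succ (p : ℕ) k, pow_mul]
        simp only [map_add, map_mul, map_pow]
        ring
      rw [h2]
      exact dvd_add (dvd_pow h hp.ne_zero) (dvd_mul_left _ _)

theorem exists_ne_zero_dvd_sum {K ι : Type*} [Field K] [Fintype ι] {M : K[X][X]} (hM : M.Monic)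
    (E : ι → K[X][X]) (m L : ℕ)
    (hE : ∀ c : ι → K[X], (∀ i, c i ∈ degreeLT K m) →
      ∀ j, ((∑ i, c i • E i) %ₘ M).coeff j ∈ degreeLT K L)
    (hcard : M.natDegree * L < Fintype.card ι * m) :
    ∃ c : ι → K[X], c ≠ 0 ∧ (∀ i, c i ∈ degreeLT K m) ∧ M ∣ ∑ i, c i • E i := by
  let T : (ι → K[X]) →ₗ[K[X]] K[X][X] := (modByMonicHom M).comp (Fintype.linearCombination K[X] E)
  have hT : ∀ c, T c = (∑ i, c i • E i) %ₘ M := fun c => by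
    rw [LinearMap.comp_apply, Fintype.linearCombination_apply, modByMonicHom_apply]
  let J : (ι → degreeLT K m) →ₗ[K] (ι → K[X]) :=
    LinearMap.pi fun i => (degreeLT K m).subtype.comp (LinearMap.proj i)
  let Ψ : (ι → degreeLT K m) →ₗ[K] (Fin M.natDegree → degreeLT K L) :=
    LinearMap.pi fun j => LinearMap.codRestrict (degreeLT K L)
      ((((lcoeff K[X] j).comp T).restrictScalars K).comp J) fun c => by
        have := hE (J c) (fun i => (c i).2) j
        rw [← hT] at this
        exact this
  have hker : LinearMap.ker Ψ ≠ ⊥ := by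
    apply LinearMap.ker_ne_bot_of_finrank_lt
    have hfin : ∀ k, Module.finrank K (degreeLT K k) = k := fun k => by
      rw [(degreeLTEquiv K k).finrank_eq, Module.finrank_fin_fun]
    rw [Module.finrank_pi_fintype, Module.finrank_pi_fintype]
    simpa [hfin] using hcard
  obtain ⟨c, hc, hc0⟩ := Submodule.exists_mem_ne_zero_of_ne_bot hker
  refine ⟨J c, fun h => hc0 ?_, fun i => (c i).2, ?_⟩
  · funext i
    exact Subtype.ext (congrFun h i)
  · rw [← modByMonic_eq_zero_iff_dvd hM, ← hT]
    ext1 j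
    rw [coeff_zero]
    by_cases hj : j < M.natDegree
    · have h1 := congrFun (LinearMap.mem_ker.1 hc) ⟨j, hj⟩
      exact congrArg Subtype.val h1
    · rw [hT]
      refine coeff_eq_zero_of_degree_lt ((degree_modByMonic_lt _ hM).trans_le ?_)
      exact degree_le_natDegree.trans (by exact_mod_cast not_lt.1 hj)

/-- The semilinear substitution behind Stepanov's method: at a point `(x, w)` with `x ^ Q = x`,
`w ^ Q = w + e`, where `Q = P R`, the `P`-th power of the auxiliary function with coefficients `c`
is a low-degree function with Frobenius-twisted coefficients. -/
theorem sum_pow_eq_of_frobenius {K ι : Type*} [Field K] [Fintype ι] {p : ℕ} [Fact p.Prime]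
    [CharP K p] {k r : ℕ} (x₀ x w e lw : K) (u v j : ι → ℕ) (c c' : ι → K[X])
    (hc : ∀ i, (c i).eval x ^ p ^ (k + r) = (c' i).eval x)
    (hw : w ^ p ^ (k + r) = w + e) (hlw : w ^ p ^ k = lw) :
    (∑ i, (x - x₀) ^ u i * (c i).eval x ^ p ^ r * (w ^ v i * (w ^ p ^ r) ^ j i)) ^ p ^ k =
      ∑ i, (c' i).eval x * ((x - x₀) ^ (u i * p ^ k) * (lw ^ v i * (w + e) ^ j i)) := by
  rw [sum_pow_char_pow]
  refine Finset.sum_congr rfl fun i _ => ?_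
  rw [← hc, ← hw, ← hlw, pow_add]
  ring

theorem natDegree_sum_linear_lt {K ι : Type*} [Field K] {p : ℕ} (s : Finset ι)
    (f b₁ b₀ d₁ d₀ : ι → K[X]) (v j : ι → Fin p) :
    (∑ i ∈ s, C (f i) * ((C (b₁ i) * X + C (b₀ i)) ^ (v i : ℕ) *
      (C (d₁ i) * X + C (d₀ i)) ^ (j i : ℕ)) : K[X][X]).natDegree < 2 * p + 1 := by
  refine Nat.lt_succ_of_le (natDegree_sum_le_of_forall_le s _ fun i _ => ?_)
  refine (natDegree_C_mul_le _ _).trans ?_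
  have h1 : ((C (b₁ i) * X + C (b₀ i)) ^ (v i : ℕ) : K[X][X]).natDegree ≤ v i * 1 :=
    natDegree_pow_le_of_le _ natDegree_linear_le
  have h2 : ((C (d₁ i) * X + C (d₀ i)) ^ (j i : ℕ) : K[X][X]).natDegree ≤ j i * 1 :=
    natDegree_pow_le_of_le _ natDegree_linear_le
  have h3 := natDegree_mul_le_of_le h1 h2
  have := (v i).2
  have := (j i).2
  omega

theorem coeffDegLE_linear_term {K : Type*} [Field K] {f b₁ b₀ d₁ d₀ : K[X]} {p δ ε η : ℕ}
    (hf : f.natDegree ≤ δ) (hb₁ : b₁.natDegree ≤ ε) (hb₀ : b₀.natDegree ≤ ε)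
    (hd₁ : d₁.natDegree ≤ η) (hd₀ : d₀.natDegree ≤ η) (v j : Fin p) :
    CoeffDegLE (δ + (p * ε + p * η))
      (C f * ((C b₁ * X + C b₀) ^ (v : ℕ) * (C d₁ * X + C d₀) ^ (j : ℕ))) :=
  (CoeffDegLE.C_of_le hf).mul
    ((((CoeffDegLE.linear hb₁ hb₀).pow _).mono (Nat.mul_le_mul_right _ v.2.le)).mul
      (((CoeffDegLE.linear hd₁ hd₀).pow _).mono (Nat.mul_le_mul_right _ j.2.le)))

theorem coeff_eval_eq_zero_of_artinSchreier {K : Type*} [Field K] {p : ℕ} [Fact p.Prime]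
    [CharP K p] {F : K[X][X]} (hF : F.natDegree < p) {x β y : K} (hβ : β ≠ 0)
    (h : ∀ b : K, b ^ p = b → F.evalEval x (β * (y + b)) = 0) (j : ℕ) : (F.coeff j).eval x = 0 := by
  have h0 : F.map (evalRingHom x) = 0 := by
    refine eq_zero_of_natDegree_lt_card_of_eval_eq_zero (F.map (evalRingHom x))
      (ι := ZMod p) (f := fun b => β * (y + ZMod.castHom dvd_rfl K b)) ?_ ?_ ?_
    · intro b b' hb
      exact (ZMod.castHom dvd_rfl K).injective (add_left_cancel (mul_left_cancel₀ hβ hb))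
    · intro b
      rw [map_evalRingHom_eval]
      refine h _ ?_
      rw [← map_pow, ZMod.pow_card]
    · rw [ZMod.card]
      exact natDegree_map_le.trans_lt hF
  have := congrArg (fun G => coeff G j) h0
  simpa using this

theorem eval_eq_zero_of_dvd {K : Type*} [Field K] {M F : K[X][X]} (h : M ∣ F) {x w : K}
    (hM : M.evalEval x w = 0) : F.evalEval x w = 0 := by
  obtain ⟨G, rfl⟩ := h
  rw [evalEval_mul, hM, zero_mul]

theorem asPoly_evalEval {K : Type*} [Field K] {p : ℕ} [Fact p.Prime] [CharP K p] {A B : K[X]}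
    {x y b : K} (hB : B.eval x ≠ 0) (hy : y ^ p - y = A.eval x / B.eval x) (hb : b ^ p = b) :
    (asPoly p A B).evalEval x (B.eval x * (y + b)) = 0 := by
  have hp : p.Prime := Fact.out
  have h1 : B.eval x ^ p = B.eval x ^ (p - 1) * B.eval x := by
    rw [← pow_succ, Nat.sub_add_cancel hp.one_lt.le]
  have h2 : (y ^ p - y) * B.eval x = A.eval x := by
    rw [hy, div_mul_cancel₀ _ hB]
  simp only [asPoly, evalEval_sub, evalEval_add, evalEval_mul, evalEval_pow, evalEval_X,
    evalEval_C, eval_pow, eval_mul]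
  rw [mul_pow, add_pow_char, hb, h1, ← h2]
  ring

theorem exists_frobenius_twist {K : Type*} [Field K] [IsAlgClosed K] {p : ℕ} [Fact p.Prime]
    [CharP K p] (n : ℕ) (f : K[X]) :
    ∃ g : K[X], g.natDegree = f.natDegree ∧ (f ≠ 0 → g ≠ 0) ∧
      ∀ x, x ^ p ^ n = x → g.eval x ^ p ^ n = f.eval x := by
  refine ⟨f.map ((iterateFrobeniusEquiv K p n).symm : K →+* K), natDegree_map _,
    fun h => (Polynomial.map_ne_zero_iff (RingHom.injective _)).2 h, fun x hx => ?_⟩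
  have h1 : ∀ z : K, z ^ p ^ n = (iterateFrobeniusEquiv K p n : K →+* K) z := fun z => rfl
  rw [h1, ← eval₂_at_apply, ← h1, hx, eval₂_map]
  have h2 : (iterateFrobeniusEquiv K p n : K →+* K).comp
      ((iterateFrobeniusEquiv K p n).symm : K →+* K) = RingHom.id K := by
    ext z
    simp
  rw [h2, eval₂_id]

theorem stepanov_dimension_count {p D dB c₀ P : ℕ} (hp : 2 ≤ p) (hP : 1 ≤ P) :
    p * (P * (p * P) + (p * (D * (p * P)) + p * dB) + (P + 2 * (p * D + dB + c₀ + 3)) + c₀ + 1) <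
      (P * (p * p)) * (P + 2 * (p * D + dB + c₀ + 3)) := by
  obtain ⟨P, rfl⟩ := Nat.exists_eq_add_of_le hP
  obtain ⟨p, rfl⟩ := Nat.exists_eq_add_of_le hp
  have h : P * (p + 2) * (D * (p + 2) + dB + c₀ + 3) ≥ 0 := Nat.zero_le _
  have key : (P + 1) * ((p + 2) * D * (p + 2)) + (p + 2) * dB + (P + 1) +
      2 * ((p + 2) * D + dB + c₀ + 3) + c₀ + 1 <
      (P + 1) * (p + 2) * (2 * ((p + 2) * D + dB + c₀ + 3)) := by
    ring_nf
    nlinarith [Nat.zero_le (P * p), Nat.zero_le (P * p * D), Nat.zero_le (P * p * dB),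
      Nat.zero_le (P * p * c₀), Nat.zero_le (p * p * D), Nat.zero_le (P * p * p * D)]
  have := Nat.mul_lt_mul_of_pos_left key (show 0 < p + 2 by omega)
  nlinarith [this]

set_option maxHeartbeats 400000 in
/-- Stepanov's bound: the number of `x` with `x ^ Q = x` over which the Frobenius acts on the
solutions of `y ^ p - y = A x / B x` as translation by `a` is at most `Q / p + O(√Q)`, provided
`A / B` has a pole of order prime to `p`. -/
theorem stepanov_bound {K : Type*} [Field K] [IsAlgClosed K] {p : ℕ} [Fact p.Prime]
    [CharP K p] (A B : K[X]) (x₀ : K) (hA : A.eval x₀ ≠ 0) (hd : ¬ p ∣ B.rootMultiplicity x₀) :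
    ∃ C : ℕ, ∀ n ≥ 2, ∀ (a : K) (S : Finset K),
      (∀ x ∈ S, x ^ p ^ n = x ∧ B.eval x ^ p ^ n = B.eval x ∧ B.eval x ≠ 0 ∧
        ∃ y, y ^ p - y = A.eval x / B.eval x ∧ y ^ p ^ n = y + a) →
      p * S.card ≤ p ^ n + C * p ^ ((n + 1) / 2) := by
  have hp : p.Prime := Fact.out
  obtain ⟨D, hD⟩ := asPoly_exists_linear_of_pow (p := p) A B
  obtain ⟨c₀, hc₀⟩ := exists_coeffDegLE_modByMonic (asPoly p A B) (2 * p + 1)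
  have hMon := asPoly_monic hp.one_lt A B
  have hMdeg := asPoly_natDegree hp.one_lt A B
  set M := asPoly p A B with hM
  set dB := B.natDegree
  set s := 2 * (p * D + dB + c₀ + 3)
  refine ⟨1 + p * s + p * (p * D) + p * c₀, fun n hn a S hS => ?_⟩
  obtain ⟨k, r, hk1, hkr, rfl, hr⟩ : ∃ k r, 1 ≤ k ∧ k ≤ r ∧ k + r = n ∧ (n + 1) / 2 = r :=
    ⟨n / 2, (n + 1) / 2, by omega, by omega, by omega, rfl⟩
  rw [hr]
  obtain ⟨P, hPk⟩ : ∃ P, P = p ^ (k - 1) := ⟨_, rfl⟩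
  have hpk : p ^ k = p * P := by
    rw [hPk, ← pow_succ', Nat.sub_add_cancel hk1]
  have hP1 : 1 ≤ P := hPk ▸ Nat.one_le_pow _ _ hp.pos
  set m := P + s
  obtain ⟨b₁, b₀, hb₁, hb₀, hbdvd⟩ := hD k
  obtain ⟨d₁, d₀, hd₁, hd₀, hddvd⟩ := hD r
  have hsmul : ∀ c : Fin P × Fin p × Fin p → K[X],
      ∑ i, c i • (C ((X - C x₀) ^ ((i.1 : ℕ) * p ^ k)) *
        ((C b₁ * X + C b₀) ^ (i.2.1 : ℕ) * (C 1 * X + C (C a * B)) ^ (i.2.2 : ℕ)) : K[X][X]) =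
      ∑ i, C (c i * (X - C x₀) ^ ((i.1 : ℕ) * p ^ k)) *
        ((C b₁ * X + C b₀) ^ (i.2.1 : ℕ) * (C 1 * X + C (C a * B)) ^ (i.2.2 : ℕ)) := fun c =>
    Finset.sum_congr rfl fun i _ => by rw [smul_eq_C_mul, ← mul_assoc, ← C_mul]
  -- a nontrivial solution of the linear system
  obtain ⟨c', hc'0, hc'deg, hc'dvd⟩ := exists_ne_zero_dvd_sum (ι := Fin P × Fin p × Fin p) hMon
    (fun i => C ((X - C x₀) ^ ((i.1 : ℕ) * p ^ k)) *
      ((C b₁ * X + C b₀) ^ (i.2.1 : ℕ) * (C 1 * X + C (C a * B)) ^ (i.2.2 : ℕ))) m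
    (P * (p * P) + (p * (D * (p * P)) + p * dB) + m + c₀ + 1) (by
      intro c hc j
      rw [mem_degreeLT]
      refine lt_of_le_of_lt degree_le_natDegree ?_
      refine Nat.cast_lt.2 (Nat.lt_succ_of_le ?_)
      rw [hsmul]
      refine hc₀ _ _ ?_ ?_ j
      · exact natDegree_sum_linear_lt (p := p) Finset.univ
          (fun i : Fin P × Fin p × Fin p => c i * (X - C x₀) ^ ((i.1 : ℕ) * p ^ k))
          (fun _ => b₁) (fun _ => b₀) (fun _ => 1) (fun _ => C a * B) (fun i => i.2.1)
          (fun i => i.2.2)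
      · refine CoeffDegLE.sum _ _ fun i _ => ?_
        have hci : (c i).natDegree ≤ m :=
          natDegree_le_iff_degree_le.2 (mem_degreeLT.1 (hc i)).le
        have hf : (c i * (X - C x₀) ^ ((i.1 : ℕ) * p ^ k)).natDegree ≤ m + P * (p * P) := by
          refine natDegree_mul_le_of_le hci ?_
          refine (natDegree_pow_le_of_le _ (natDegree_X_sub_C_le x₀)).trans ?_
          rw [mul_one, hpk]
          exact Nat.mul_le_mul_right _ i.1.2.le
        have h1 : (1 : K[X]).natDegree ≤ dB := by simp
        have h2 : (C a * B).natDegree ≤ dB := natDegree_C_mul_le _ _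
        rw [hpk] at hb₁ hb₀
        refine (coeffDegLE_linear_term hf hb₁ hb₀ h1 h2 i.2.1 i.2.2).mono ?_
        omega) (by
      rw [hMdeg]
      simp only [Fintype.card_prod, Fintype.card_fin]
      exact stepanov_dimension_count hp.two_le hP1)
  choose g hgdeg hg0 hgeval using fun f : K[X] => exists_frobenius_twist (p := p) (k + r) f
  set c : Fin P × Fin p × Fin p → K[X] := fun i => g (c' i) with hcdef
  have hc0 : c ≠ 0 := by
    obtain ⟨i, hi⟩ := Function.ne_iff.1 hc'0
    exact Function.ne_iff.2 ⟨i, hg0 _ hi⟩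
  -- the auxiliary function
  set G : K[X][X] := ∑ i, C ((X - C x₀) ^ (i.1 : ℕ) * c i ^ p ^ r) *
      (X ^ (i.2.1 : ℕ) * (X ^ p ^ r) ^ (i.2.2 : ℕ)) with hG
  set H : K[X][X] := ∑ i, C ((X - C x₀) ^ (i.1 : ℕ) * c i ^ p ^ r) *
      ((C 1 * X + C 0) ^ (i.2.1 : ℕ) * (C d₁ * X + C d₀) ^ (i.2.2 : ℕ)) with hH
  have hGH : M ∣ G - H := by
    rw [hG, hH, ← Finset.sum_sub_distrib]
    refine Finset.dvd_sum fun i _ => ?_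
    rw [← mul_sub]
    refine dvd_mul_of_dvd_right ?_ _
    rw [C_1, one_mul, C_0, add_zero, ← mul_sub]
    exact dvd_mul_of_dvd_right (hddvd.trans (sub_dvd_pow_sub_pow _ _ _)) _
  have hpR : p * P ≤ p ^ r := hpk ▸ Nat.pow_le_pow_right hp.pos hkr
  have hGn : ¬ M ∣ G := asPoly_not_dvd_sum hp A B x₀ hA hd
    (dvd_pow_self p (by omega)) hpR c hc0
  have hHn : H %ₘ M ≠ 0 := by
    rw [Ne, modByMonic_eq_zero_iff_dvd hMon]
    intro h
    exact hGn ((dvd_sub_left h).1 hGH)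
  have hGzero : ∀ x w : K, x ^ p ^ (k + r) = x → w ^ p ^ (k + r) = w + a * B.eval x →
      M.evalEval x w = 0 → G.evalEval x w = 0 := by
    intro x w hx hw hMw
    have hlw : w ^ p ^ k = b₁.eval x * w + b₀.eval x := by
      have := eval_eq_zero_of_dvd hbdvd hMw
      simpa [evalEval_sub, evalEval_add, evalEval_mul, evalEval_pow, evalEval_X, evalEval_C,
        sub_eq_zero] using this
    have h1 := sum_pow_eq_of_frobenius x₀ x w (a * B.eval x) _ (fun i => (i.1 : ℕ))
      (fun i => (i.2.1 : ℕ)) (fun i => (i.2.2 : ℕ)) c c' (fun i => hgeval (c' i) x hx) hw hlw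
    have h2 := eval_eq_zero_of_dvd hc'dvd hMw
    rw [hsmul] at h2
    simp only [evalEval_finsetSum, evalEval_add, evalEval_mul, evalEval_pow,
      evalEval_X, evalEval_C, eval_pow, eval_mul, eval_sub, eval_C, eval_X, eval_one,
      one_mul] at h2
    simp only [mul_assoc] at h1 h2
    rw [h2] at h1
    have h3 := eq_zero_of_pow_eq_zero h1
    rw [hG]
    simpa only [evalEval_finsetSum, evalEval_mul, evalEval_pow,
      evalEval_X, evalEval_C, eval_pow, eval_mul, eval_sub, eval_C, eval_X,
      mul_assoc] using h3
  have hHzero : ∀ x ∈ S, ∀ j, ((H %ₘ M).coeff j).eval x = 0 := by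
    intro x hx j
    obtain ⟨hx1, hBx, hB0, y, hy, hyQ⟩ := hS x hx
    have hlt : (H %ₘ M).natDegree < p :=
      hMdeg ▸ natDegree_modByMonic_lt _ hMon fun h => by
        rw [h, natDegree_one] at hMdeg
        exact hp.ne_zero hMdeg.symm
    refine coeff_eval_eq_zero_of_artinSchreier hlt hB0 (y := y) (fun b hb => ?_) j
    have hMw := asPoly_evalEval hB0 hy hb
    have hbQ : ∀ t : ℕ, b ^ p ^ t = b := fun t => by
      induction t with
      | zero => simp
      | succ t ih => rw [pow_succ, pow_mul, ih, hb]
    have hw : (B.eval x * (y + b)) ^ p ^ (k + r) = B.eval x * (y + b) + a * B.eval x := by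
      rw [mul_pow, hBx, add_pow_char_pow, hyQ, hbQ]
      ring
    have h1 := hGzero x _ hx1 hw hMw
    have h2 := eval_eq_zero_of_dvd hGH hMw
    rw [evalEval_sub, h1, zero_sub, neg_eq_zero] at h2
    have h3 := congrArg (evalEval x (B.eval x * (y + b))) (modByMonic_add_div H M)
    rwa [evalEval_add, evalEval_mul, hMw, zero_mul, add_zero, h2] at h3
  obtain ⟨j, hj⟩ : ∃ j, (H %ₘ M).coeff j ≠ 0 := by
    by_contra! h
    exact hHn (Polynomial.ext fun j => by simpa using h j)
  have hcard : S.card ≤ ((H %ₘ M).coeff j).natDegree :=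
    card_le_degree_of_subset_roots fun x hx =>
      (mem_roots hj).2 (hHzero x hx j)
  have hdeg : ((H %ₘ M).coeff j).natDegree ≤ (P + p ^ r * m + p * (D * p ^ r)) + c₀ := by
    refine hc₀ _ _ ?_ ?_ j
    · exact natDegree_sum_linear_lt (p := p) Finset.univ
        (fun i : Fin P × Fin p × Fin p => (X - C x₀) ^ (i.1 : ℕ) * c i ^ p ^ r)
        (fun _ => 1) (fun _ => 0) (fun _ => d₁) (fun _ => d₀) (fun i => i.2.1) (fun i => i.2.2)
    · refine CoeffDegLE.sum _ _ fun i _ => ?_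
      have hci : (c i).natDegree ≤ m := by
        rw [hcdef]
        exact (hgdeg _).trans_le (natDegree_le_iff_degree_le.2 (mem_degreeLT.1 (hc'deg i)).le)
      have hf : ((X - C x₀) ^ (i.1 : ℕ) * c i ^ p ^ r).natDegree ≤ P + p ^ r * m := by
        refine natDegree_mul_le_of_le ?_ (natDegree_pow_le_of_le _ hci)
        refine (natDegree_pow_le_of_le _ (natDegree_X_sub_C_le x₀)).trans ?_
        rw [mul_one]
        exact i.1.2.le
      refine (coeffDegLE_linear_term (ε := 0) hf (by simp) (by simp) hd₁ hd₀ i.2.1 i.2.2).mono ?_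
      omega
  have hR1 : 1 ≤ p ^ r := Nat.one_le_pow _ _ hp.pos
  calc p * S.card ≤ p * ((P + p ^ r * m + p * (D * p ^ r)) + c₀) :=
        Nat.mul_le_mul_left _ (hcard.trans hdeg)
    _ = p ^ r * (p * P) + (p * P + p * s * p ^ r + p * (p * D) * p ^ r + p * c₀ * 1) := by
        simp only [m]
        ring
    _ ≤ p ^ r * (p * P) + (p ^ r + p * s * p ^ r + p * (p * D) * p ^ r + p * c₀ * p ^ r) := by
        gcongr
    _ = p ^ (k + r) + (1 + p * s + p * (p * D) + p * c₀) * p ^ r := by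
        rw [pow_add, hpk]
        ring

theorem eval₂_pow_eq_self {F K : Type*} [Field F] [Fintype F] [Field K] [Algebra F K] {p e : ℕ}
    [Fact p.Prime] [CharP K p] (hq : Fintype.card F = p ^ e) {N : ℕ} {x : K}
    (hx : x ^ p ^ (e * N) = x) (f : F[X]) :
    f.eval₂ (algebraMap F K) x ^ p ^ (e * N) = f.eval₂ (algebraMap F K) x := by
  have h := f.hom_eval₂ (algebraMap F K) (iterateFrobenius K p (e * N)) x
  have hc : (iterateFrobenius K p (e * N)).comp (algebraMap F K) = algebraMap F K := by
    ext c
    simp [iterateFrobenius_def, pow_mul, ← hq, ← map_pow, FiniteField.pow_card_pow]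
  rwa [hc, iterateFrobenius_def, iterateFrobenius_def, hx] at h

theorem pow_eq_add_sum_of_artinSchreier {K : Type*} [Field K] {p : ℕ} [Fact p.Prime] [CharP K p]
    {y t : K} (h : y ^ p - y = t) (M : ℕ) :
    y ^ p ^ M = y + ∑ i ∈ Finset.range M, t ^ p ^ i := by
  induction M with
  | zero => simp
  | succ M ih =>
    have : t ^ p ^ M = (y ^ p) ^ p ^ M - y ^ p ^ M := by rw [← h, sub_pow_char_pow]
    rw [Finset.sum_range_succ, this, ← add_assoc, ← ih, pow_succ', pow_mul]
    ring

universe u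

/-- A uniform bound for the fibers of `x ↦ tr (n x)` over the extensions of a finite field `F`
of order `p ^ e`, realized inside an algebraic closure `K`. -/
def TraceFiberBound (K : Type u) {F : Type u} [Field F] [Field K] [Algebra F K] (p e : ℕ)
    (n : RatFunc F) : Prop :=
  ∃ C : ℕ, ∀ N ≥ 2, ∀ (a : K) (S : Finset K),
    (∀ x ∈ S, x ^ p ^ (e * N) = x ∧ n.denom.eval₂ (algebraMap F K) x ≠ 0 ∧
      ∑ i ∈ Finset.range (e * N), n.eval (algebraMap F K) x ^ p ^ i = a) →
    p * S.card ≤ p ^ (e * N) + C * p ^ ((e * N + 1) / 2)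

section TraceFiberBound

variable {F K : Type u} [Field F] [Fintype F] [Field K] [Algebra F K] [IsAlgClosed K] {p e : ℕ}
  [Fact p.Prime] [CharP K p]

theorem trace_fiber_bound (hq : Fintype.card F = p ^ e) (he : 0 < e) (A B : F[X]) (x₀ : K)
    (hA : A.eval₂ (algebraMap F K) x₀ ≠ 0)
    (hd : ¬ p ∣ (B.map (algebraMap F K)).rootMultiplicity x₀) :
    ∃ C : ℕ, ∀ N ≥ 2, ∀ (a : K) (S : Finset K),
      (∀ x ∈ S, x ^ p ^ (e * N) = x ∧ B.eval₂ (algebraMap F K) x ≠ 0 ∧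
        ∑ i ∈ Finset.range (e * N),
          (A.eval₂ (algebraMap F K) x / B.eval₂ (algebraMap F K) x) ^ p ^ i = a) →
      p * S.card ≤ p ^ (e * N) + C * p ^ ((e * N + 1) / 2) := by
  have hp := (Fact.out : p.Prime)
  obtain ⟨C, hC⟩ := stepanov_bound (p := p) (A.map (algebraMap F K)) (B.map (algebraMap F K)) x₀
    (by rwa [eval_map]) hd
  refine ⟨C, fun N hN a S hS => hC (e * N) (by nlinarith) a S fun x hx => ?_⟩
  obtain ⟨h1, h2, h3⟩ := hS x hx
  simp only [eval_map]
  refine ⟨h1, eval₂_pow_eq_self hq h1 B, h2, ?_⟩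
  set t := A.eval₂ (algebraMap F K) x / B.eval₂ (algebraMap F K) x
  obtain ⟨y, hy⟩ := IsAlgClosed.exists_root (X ^ p - X - Polynomial.C t : K[X]) (by
    have : (X ^ p - X - Polynomial.C t : K[X]).degree = p := by
      have h1 : (X + Polynomial.C t : K[X]).degree < p := by
        rw [degree_X_add_C]; exact_mod_cast hp.one_lt
      rw [sub_sub, degree_sub_eq_left_of_degree_lt (by rwa [degree_X_pow]), degree_X_pow]
    rw [this]; exact_mod_cast hp.ne_zero)
  have hy' : y ^ p - y = t := by
    simpa [IsRoot, sub_eq_zero] using hy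
  exact ⟨y, hy', by rw [pow_eq_add_sum_of_artinSchreier hy', h3]⟩

omit [IsAlgClosed K] in
theorem sum_pow_artinSchreier {y : K} {M : ℕ} (hy : y ^ p ^ M = y) :
    ∑ i ∈ Finset.range M, (y ^ p - y) ^ p ^ i = 0 := by
  have := pow_eq_add_sum_of_artinSchreier (K := K) (p := p) (y := y) rfl M
  rw [hy] at this
  simpa using this.symm

omit [Fintype F] [IsAlgClosed K] in
theorem card_le_of_eval₂_eq_zero {f : F[X]} (hf : f ≠ 0) {S : Finset K}
    (hS : ∀ x ∈ S, f.eval₂ (algebraMap F K) x = 0) : S.card ≤ f.natDegree := by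
  classical
  have hf' : f.map (algebraMap F K) ≠ 0 := (Polynomial.map_ne_zero_iff (algebraMap F K).injective).2 hf
  rw [← natDegree_map (algebraMap F K)]
  refine (Finset.card_le_card (t := (f.map (algebraMap F K)).roots.toFinset) fun x hx => ?_).trans
    ((Multiset.toFinset_card_le _).trans (card_roots' _))
  rw [Multiset.mem_toFinset, mem_roots hf', IsRoot, eval_map]
  exact hS x hx

omit [IsAlgClosed K] in
theorem TraceFiberBound.add_artinSchreier (hq : Fintype.card F = p ^ e) {n : RatFunc F}
    (h : TraceFiberBound K p e n) (g : RatFunc F) :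
    TraceFiberBound K p e (n + (g ^ p - g)) := by
  classical
  have hp := (Fact.out : p.Prime)
  obtain ⟨C, hC⟩ := h
  let D := n.denom * g.denom
  have hD0 : D ≠ 0 := mul_ne_zero n.denom_ne_zero g.denom_ne_zero
  refine ⟨C + p * D.natDegree, fun N hN a S hS => ?_⟩
  let φ := algebraMap F K
  let S₁ := S.filter fun x => D.eval₂ φ x ≠ 0
  let S₀ := S.filter fun x => ¬ D.eval₂ φ x ≠ 0
  have h0 : S₀.card ≤ D.natDegree :=
    card_le_of_eval₂_eq_zero hD0 fun x hx => not_not.1 (Finset.mem_filter.1 hx).2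
  have h1 : p * S₁.card ≤ p ^ (e * N) + C * p ^ ((e * N + 1) / 2) := by
    refine hC N hN a S₁ fun x hx => ?_
    obtain ⟨hxS, hxD⟩ := Finset.mem_filter.1 hx
    obtain ⟨hx1, hx2, hx3⟩ := hS x hxS
    have hxn : n.denom.eval₂ φ x ≠ 0 := fun h => hxD (by simp [D, eval₂_mul, h])
    have hxg : g.denom.eval₂ φ x ≠ 0 := fun h => hxD (by simp [D, eval₂_mul, h])
    refine ⟨hx1, hxn, ?_⟩
    have key : (n + (g ^ p - g)).eval φ x = n.eval φ x + (g.eval φ x ^ p - g.eval φ x) := by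
      have dvd {u v : F[X]} (huv : u ∣ v) (hv : v.eval₂ φ x ≠ 0) : u.eval₂ φ x ≠ 0 := by
        obtain ⟨w, rfl⟩ := huv
        exact fun h => hv (by simp [eval₂_mul, h])
      have pw (m : ℕ) : (g ^ m).denom.eval₂ φ x ≠ 0 ∧ (g ^ m).eval φ x = g.eval φ x ^ m := by
        induction m with
        | zero => simp
        | succ m ih =>
          rw [pow_succ, pow_succ, RatFunc.eval_mul φ (a := x) ih.1 hxg, ih.2]
          refine ⟨dvd (RatFunc.denom_mul_dvd _ _) ?_, rfl⟩
          rw [eval₂_mul]; exact mul_ne_zero ih.1 hxg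
      have hneg : (-g).denom.eval₂ φ x ≠ 0 ∧ (-g).eval φ x = - g.eval φ x := by
        have hm1 : (-g) = RatFunc.C (-1) * g := by simp
        have hC : (RatFunc.C (-1 : F)).denom.eval₂ φ x ≠ 0 := by
          rw [RatFunc.denom_C]; simp
        rw [hm1, RatFunc.eval_mul φ (a := x) hC hxg]
        refine ⟨dvd (RatFunc.denom_mul_dvd _ _) ?_, by rw [RatFunc.eval_C]; simp⟩
        rw [eval₂_mul]; exact mul_ne_zero hC hxg
      have hadd : (g ^ p + -g).denom.eval₂ φ x ≠ 0 := by
        refine dvd (RatFunc.denom_add_dvd _ _) ?_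
        rw [eval₂_mul]; exact mul_ne_zero (pw p).1 hneg.1
      rw [sub_eq_add_neg, RatFunc.eval_add φ (a := x) hxn hadd, RatFunc.eval_add φ (a := x) (pw p).1 hneg.1,
        (pw p).2, hneg.2, sub_eq_add_neg]
    rw [show algebraMap F K = φ from rfl, key] at hx3
    simp only [add_pow_char_pow, Finset.sum_add_distrib] at hx3
    rwa [sum_pow_artinSchreier, add_zero] at hx3
    rw [RatFunc.eval, div_pow, eval₂_pow_eq_self hq hx1, eval₂_pow_eq_self hq hx1]
  have hS : S.card = S₁.card + S₀.card := (Finset.card_filter_add_card_filter_not _).symm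
  have h2 : 1 ≤ p ^ ((e * N + 1) / 2) := Nat.one_le_pow _ _ hp.pos
  rw [hS, mul_add]
  calc _ ≤ p ^ (e * N) + C * p ^ ((e * N + 1) / 2) + p * D.natDegree :=
        add_le_add h1 (Nat.mul_le_mul_left _ h0)
    _ ≤ _ := by nlinarith [Nat.le_mul_of_pos_right (p * D.natDegree) h2]

end TraceFiberBound

theorem exists_pow_eq_of_dvd_rootMultiplicity {F K : Type*} [Field F] [Finite F] [Field K]
    [IsAlgClosed K] [Algebra F K] {p : ℕ} [Fact p.Prime] [CharP F p] {B : F[X]} (hB : B.Monic)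
    (h : ∀ x : K, p ∣ (B.map (algebraMap F K)).rootMultiplicity x) : ∃ b : F[X], b ^ p = B := by
  classical
  have hp := (Fact.out : p.Prime)
  have := charP_of_injective_algebraMap (algebraMap F K).injective p
  choose m hm using h
  let φ := algebraMap F K
  have hBφ : B.map φ = (∏ x ∈ (B.map φ).roots.toFinset, (X - Polynomial.C x) ^ m x) ^ p := by
    conv_lhs => rw [(IsAlgClosed.splits (B.map φ)).eq_prod_roots_of_monic (hB.map φ)]
    rw [prod_multiset_root_eq_finset_root, ← Finset.prod_pow]
    refine Finset.prod_congr rfl fun x _ => ?_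
    rw [hm x, mul_comm, pow_mul]
  have hd : derivative B = 0 := by
    apply map_injective φ φ.injective
    rw [← derivative_map, hBφ, derivative_pow]
    simp
  refine ⟨(contract p B).map ((frobeniusEquiv F p).symm : F →+* F), ?_⟩
  conv_rhs => rw [← expand_contract p hd hp.ne_zero]
  rw [polynomial_expand_eq]

section TraceFiberBound

variable {F K : Type u} [Field F] [Fintype F] [Field K] [Algebra F K] [IsAlgClosed K] {p e : ℕ}
  [Fact p.Prime] [CharP K p]

theorem traceFiberBound_of_not_dvd_rootMultiplicity (hq : Fintype.card F = p ^ e) (he : 0 < e)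
    (n : RatFunc F) (x₀ : K)
    (h : ¬ p ∣ (n.denom.map (algebraMap F K)).rootMultiplicity x₀) : TraceFiberBound K p e n := by
  refine trace_fiber_bound hq he n.num n.denom x₀ (fun h0 => h ?_) h
  have : ¬ (n.denom.map (algebraMap F K)).IsRoot x₀ := fun hr => by
    obtain ⟨u, v, huv⟩ := n.isCoprime_num_denom
    rw [IsRoot, eval_map] at hr
    simpa [eval₂_add, eval₂_mul, h0, hr] using congrArg (eval₂ (algebraMap F K) x₀) huv
  simp [rootMultiplicity_eq_zero this]

theorem traceFiberBound_of_not_dvd_natDegree (hq : Fintype.card F = p ^ e) (he : 0 < e)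
    (A : F[X]) (h : ¬ p ∣ A.natDegree) :
    TraceFiberBound K p e (algebraMap F[X] (RatFunc F) A) := by
  classical
  have hp := (Fact.out : p.Prime)
  have hA : A ≠ 0 := by rintro rfl; simp at h
  obtain ⟨C, hC⟩ := trace_fiber_bound (K := K) hq he A.reverse (X ^ A.natDegree) 0
    (by rw [eval₂_at_zero, coeff_zero_reverse]; simpa) (by
      have := rootMultiplicity_X_sub_C_pow (0 : K) A.natDegree
      rw [Polynomial.C_0, sub_zero] at this
      rwa [Polynomial.map_pow, map_X, this])
  refine ⟨C + p, fun N hN a S hS => ?_⟩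
  have key := hC N hN a ((S.erase 0).image (·⁻¹)) (by
    simp only [Finset.mem_image, Finset.mem_erase, forall_exists_index, and_imp]
    rintro _ x hx0 hxS rfl
    obtain ⟨h1, -, h3⟩ := hS x hxS
    refine ⟨by rw [inv_pow, h1], by simpa [eval₂_pow] using fun h => absurd h hx0, ?_⟩
    have := invertibleOfNonzero hx0
    have hev := eval₂_reverse_mul_pow (algebraMap F K) x A
    rw [invOf_eq_inv] at hev
    rw [← h3]
    refine Finset.sum_congr rfl fun i _ => ?_
    simp only [RatFunc.eval, RatFunc.num_algebraMap, RatFunc.denom_algebraMap]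
    rw [← hev]
    simp [eval₂_pow])
  rw [Finset.card_image_of_injective _ inv_injective] at key
  have h1 : S.card ≤ (S.erase 0).card + 1 := by
    have := Finset.pred_card_le_card_erase (s := S) (a := 0)
    omega
  have h2 : 1 ≤ p ^ ((e * N + 1) / 2) := Nat.one_le_pow _ _ hp.pos
  calc _ ≤ p * (S.erase 0).card + p := by nlinarith
    _ ≤ p ^ (e * N) + C * p ^ ((e * N + 1) / 2) + p := by gcongr
    _ ≤ _ := by nlinarith [Nat.le_mul_of_pos_right p h2]

omit [IsAlgClosed K] in
theorem traceFiberBound_or_eq_add_artinSchreier (hq : Fintype.card F = p ^ e) {n : RatFunc F}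
    (h : TraceFiberBound K p e n ∨ ∃ (g : RatFunc F) (c : F), n = g ^ p - g + RatFunc.C c)
    (g : RatFunc F) : TraceFiberBound K p e (n + (g ^ p - g)) ∨
      ∃ (g' : RatFunc F) (c : F), n + (g ^ p - g) = g' ^ p - g' + RatFunc.C c := by
  have := (algebraMap F K).charP (algebraMap F K).injective p
  rcases h with h | ⟨g', c, rfl⟩
  · exact .inl (h.add_artinSchreier hq g)
  · refine .inr ⟨g' + g, c, ?_⟩
    rw [add_pow_char]
    ring

theorem traceFiberBound_or_eq_artinSchreier_polynomial (hq : Fintype.card F = p ^ e) (he : 0 < e)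
    (A : F[X]) : TraceFiberBound K p e (algebraMap F[X] (RatFunc F) A) ∨
      ∃ (g : RatFunc F) (c : F),
        algebraMap F[X] (RatFunc F) A = g ^ p - g + RatFunc.C c := by
  have := (algebraMap F K).charP (algebraMap F K).injective p
  have hp := (Fact.out : p.Prime)
  induction hd : A.natDegree using Nat.strong_induction_on generalizing A with
  | _ d ih =>
  subst hd
  by_cases hdvd : p ∣ A.natDegree
  swap
  · exact .inl (traceFiberBound_of_not_dvd_natDegree hq he A hdvd)
  rcases Nat.eq_zero_or_pos A.natDegree with h0 | hpos
  · refine .inr ⟨0, A.coeff 0, ?_⟩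
    conv_lhs => rw [eq_C_of_natDegree_eq_zero h0]
    rw [RatFunc.algebraMap_C, zero_pow hp.ne_zero]; simp
  obtain ⟨k, hk⟩ := hdvd
  have hk0 : 0 < k := Nat.pos_of_ne_zero (by rintro rfl; simp at hk; omega)
  obtain ⟨β, hβ⟩ := (frobeniusEquiv F p).surjective A.leadingCoeff
  rw [frobeniusEquiv_apply, frobenius_def] at hβ
  have hA : A ≠ 0 := by rintro rfl; simp at hpos
  set G : F[X] := C β * X ^ k with hG
  have hG1 : G ^ p = C A.leadingCoeff * X ^ A.natDegree := by
    rw [hG, mul_pow, ← C_pow, hβ, ← pow_mul, hk, mul_comm k]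
  have hlt : (A - (G ^ p - G)).natDegree < A.natDegree := by
    rcases eq_or_ne (A - (G ^ p - G)) 0 with h0 | h0
    · rwa [h0, natDegree_zero]
    refine (natDegree_lt_iff_degree_lt h0).2 ?_
    rw [sub_sub_eq_add_sub, add_sub_right_comm]
    refine (degree_add_le _ _).trans_lt (max_lt ?_ ?_)
    · have hlc : A.leadingCoeff ≠ 0 := leadingCoeff_ne_zero.2 hA
      rw [← degree_eq_natDegree hA, hG1]
      refine degree_sub_lt_left ?_ hA ?_
      · rw [degree_C_mul_X_pow _ hlc, degree_eq_natDegree hA]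
      · rw [leadingCoeff_C_mul_X_pow]
    · refine (degree_C_mul_X_pow_le k β).trans_lt ?_
      rw [hk]
      exact_mod_cast (by nlinarith [hp.two_le] : k < p * k)
  have := traceFiberBound_or_eq_add_artinSchreier hq (ih _ hlt _ rfl)
    (algebraMap F[X] (RatFunc F) G)
  rwa [← map_pow, ← map_sub, ← map_add, sub_add_cancel] at this

theorem traceFiberBound_or_eq_artinSchreier (hq : Fintype.card F = p ^ e) (he : 0 < e)
    (n : RatFunc F) : TraceFiberBound K p e n ∨
      ∃ (g : RatFunc F) (c : F), n = g ^ p - g + RatFunc.C c := by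
  have := (algebraMap F K).charP (algebraMap F K).injective p
  have hp := (Fact.out : p.Prime)
  induction hd : n.denom.natDegree using Nat.strong_induction_on generalizing n with
  | _ d ih =>
  subst hd
  by_cases hx : ∃ x₀ : K, ¬ p ∣ (n.denom.map (algebraMap F K)).rootMultiplicity x₀
  · obtain ⟨x₀, hx₀⟩ := hx
    exact .inl (traceFiberBound_of_not_dvd_rootMultiplicity hq he n x₀ hx₀)
  push Not at hx
  obtain ⟨b, hb⟩ := exists_pow_eq_of_dvd_rootMultiplicity n.monic_denom hx
  have hb0 : b ≠ 0 := by
    rintro rfl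
    exact n.denom_ne_zero (by rw [← hb, zero_pow hp.ne_zero])
  by_cases hbu : IsUnit b
  · have h1 : n.denom = 1 := n.monic_denom.eq_one_of_isUnit (hb ▸ hbu.pow p)
    have := n.num_div_denom
    rw [h1, map_one, div_one] at this
    rw [← this]
    exact traceFiberBound_or_eq_artinSchreier_polynomial hq he _
  obtain ⟨P, hP, c, rfl⟩ := WfDvdMonoid.exists_irreducible_factor hbu hb0
  have hc0 : c ≠ 0 := right_ne_zero_of_mul hb0
  obtain ⟨h, hh⟩ : ∃ h : F[X], P ∣ n.num - h ^ p := by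
    have := Fact.mk hP
    have := (charP_of_injective_algebraMap (algebraMap F (AdjoinRoot P)).injective p)
    have : Module.Finite F (AdjoinRoot P) := (AdjoinRoot.powerBasis hP.ne_zero).finite
    have : Finite (AdjoinRoot P) := Module.finite_of_finite F
    obtain ⟨z, hz⟩ := (frobeniusEquiv (AdjoinRoot P) p).surjective (AdjoinRoot.mk P n.num)
    obtain ⟨h, rfl⟩ := AdjoinRoot.mk_surjective z
    rw [frobeniusEquiv_apply, frobenius_def, ← map_pow] at hz
    exact ⟨h, AdjoinRoot.mk_eq_mk.1 hz.symm⟩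
  set b := P * c
  have hPb : P ∣ b ^ (p - 1) :=
    (dvd_mul_right P c).trans (dvd_pow_self _ (by have := hp.two_le; omega))
  obtain ⟨r, hr⟩ := dvd_add hh (hPb.mul_left h)
  have hPdvd : P ∣ b ^ p := (dvd_mul_right P c).trans (dvd_pow_self _ hp.ne_zero)
  obtain ⟨s, hs⟩ := hPdvd
  have hs0 : s ≠ 0 := by rintro rfl; simp [hb0, hp.ne_zero] at hs
  let ι := algebraMap F[X] (RatFunc F)
  have hι {f : F[X]} (hf : f ≠ 0) : ι f ≠ 0 := by simpa [ι] using hf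
  let g : RatFunc F := ι h / ι b
  have hn' : n - (g ^ p - g) = ι r / ι s := by
    have e1 : n = ι n.num / ι (b ^ p) := by rw [hb]; exact n.num_div_denom.symm
    have hb1 := hι hb0
    have hs1 := hι hs0
    have hP1 := hι hP.ne_zero
    have e2 : g = ι (h * b ^ (p - 1)) / ι (b ^ p) := by
      rw [eq_div_iff (by rw [map_pow]; exact pow_ne_zero _ hb1), map_mul, map_pow, map_pow,
        ← Nat.sub_add_cancel hp.one_le, Nat.add_sub_cancel, pow_succ]
      simp only [g]; field_simp
    have e3 : g ^ p = ι (h ^ p) / ι (b ^ p) := by simp only [g, div_pow, map_pow]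
    rw [e3, e2]
    nth_rw 1 [e1]
    rw [sub_sub_eq_add_sub, ← add_div, ← sub_div, ← map_add, ← map_sub, add_sub_right_comm, hr, hs,
      map_mul, map_mul]
    field_simp
  have hlt : (n - (g ^ p - g)).denom.natDegree < n.denom.natDegree := by
    rw [hn', ← hb, hs, natDegree_mul hP.ne_zero hs0]
    have : (ι r / ι s).denom.natDegree ≤ s.natDegree :=
      natDegree_le_of_dvd (RatFunc.denom_div_dvd r s) hs0
    have := hP.natDegree_pos
    omega
  have := traceFiberBound_or_eq_add_artinSchreier hq (ih _ hlt _ rfl) g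
  rwa [sub_add_cancel] at this

end TraceFiberBound

theorem algebraMap_hasseSymbol {F K : Type} [Field F] [Fintype F] [Field K] [Algebra F K]
    {p e : ℕ} [Fact p.Prime] [Algebra (ZMod p) F] (hq : Fintype.card F = p ^ e)
    {P : F[X]} (hP : Irreducible P) (n : RatFunc F) {x : K}
    (hx : P.eval₂ (algebraMap F K) x = 0) :
    algebraMap F K (algebraMap (ZMod p) F (hasseSymbol p P n)) =
      ∑ i ∈ Finset.range (e * P.natDegree), n.eval (algebraMap F K) x ^ p ^ i := by
  have hp := (Fact.out : p.Prime)
  have := Fact.mk hP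
  have : Module.Finite F (AdjoinRoot P) := (AdjoinRoot.powerBasis hP.ne_zero).finite
  have : Finite (AdjoinRoot P) := Module.finite_of_finite F
  have hfin : Module.finrank (ZMod p) (AdjoinRoot P) = e * P.natDegree := by
    rw [← Module.finrank_mul_finrank (ZMod p) F (AdjoinRoot P),
      (AdjoinRoot.powerBasis hP.ne_zero).finrank, AdjoinRoot.powerBasis_dim]
    congr 1
    have := Module.card_eq_pow_finrank (K := ZMod p) (V := F)
    rw [hq, ZMod.card] at this
    exact (Nat.pow_right_injective hp.two_le this).symm
  let ψ : AdjoinRoot P →+* K := AdjoinRoot.lift (algebraMap F K) x hx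
  have hψ (f : F[X]) : ψ (AdjoinRoot.mk P f) = f.eval₂ (algebraMap F K) x := AdjoinRoot.lift_mk hx f
  have h1 := congrArg ψ (FiniteField.algebraMap_trace_eq_sum_pow (ZMod p) (AdjoinRoot P)
    (AdjoinRoot.mk P n.num * Ring.inverse (AdjoinRoot.mk P n.denom)))
  rw [hfin, map_sum, Nat.card_zmod] at h1
  have h2 : ψ.comp (algebraMap (ZMod p) (AdjoinRoot P)) =
      (algebraMap F K).comp (algebraMap (ZMod p) F) := Subsingleton.elim _ _
  have h3 := RingHom.congr_fun h2 (hasseSymbol p P n)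
  simp only [RingHom.comp_apply] at h3
  rw [← h3, hasseSymbol, Algebra.trace_trace, h1]
  refine Finset.sum_congr rfl fun i _ => ?_
  rw [Ring.inverse_eq_inv, map_pow, map_mul, map_inv₀, hψ, hψ, ← div_eq_mul_inv, RatFunc.eval]

theorem exists_finset_roots_of_irreducible {F : Type*} (K : Type*) [Field F] [Fintype F] [Field K]
    [Algebra F K] [IsAlgClosed K] {N : ℕ} (T : Finset F[X])
    (hT : ∀ P ∈ T, P.Monic ∧ Irreducible P ∧ P.natDegree = N) :
    ∃ S : Finset K, S.card = N * T.card ∧ ∀ x, x ∈ S ↔ ∃ P ∈ T, P.eval₂ (algebraMap F K) x = 0 := by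
  classical
  let φ := algebraMap F K
  have hmem {P : F[X]} (hP : P ∈ T) (x : K) : x ∈ (P.map φ).roots.toFinset ↔ P.eval₂ φ x = 0 := by
    rw [Multiset.mem_toFinset, mem_roots ((hT P hP).1.map φ).ne_zero, IsRoot, eval_map]
  refine ⟨T.biUnion fun P => (P.map φ).roots.toFinset, ?_, fun x => ?_⟩
  · rw [Finset.card_biUnion, Finset.sum_const_nat (m := N), mul_comm]
    · intro P hP
      have hsep : (P.map φ).Separable := (PerfectField.separable_of_irreducible (hT P hP).2.1).map
      rw [Multiset.toFinset_card_of_nodup (nodup_roots hsep),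
        ← (IsAlgClosed.splits (P.map φ)).natDegree_eq_card_roots, natDegree_map, (hT P hP).2.2]
    · intro P hP P' hP' hne
      rw [Function.onFun, Finset.disjoint_left]
      intro x hx hx'
      rw [hmem hP] at hx
      rw [hmem hP'] at hx'
      exact hne ((minpoly.eq_of_irreducible_of_monic (hT P hP).2.1 hx (hT P hP).1).trans
        (minpoly.eq_of_irreducible_of_monic (hT P' hP').2.1 hx' (hT P' hP').1).symm)
  · rw [Finset.mem_biUnion]
    exact exists_congr fun P => and_congr_right fun hP => hmem hP x

theorem eval₂_eq_zero_pow_card_pow {F K : Type*} [Field F] [Fintype F] [Field K] [Algebra F K]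
    {P : F[X]} (hP : Irreducible P) {x : K} (hx : P.eval₂ (algebraMap F K) x = 0) :
    x ^ Fintype.card F ^ P.natDegree = x := by
  obtain ⟨r, hr⟩ := hP.natDegree_dvd_iff_dvd_X_pow_card_pow_sub_X.1 (dvd_refl P.natDegree)
  have := congrArg (eval₂ (algebraMap F K) x) hr
  rw [eval₂_mul, hx, zero_mul, Nat.card_eq_fintype_card] at this
  simpa [sub_eq_zero] using this

theorem card_filter_pow_eq {F K : Type*} [Field F] [Fintype F] [Field K] [Algebra F K]
    [IsAlgClosed K] {d : ℕ} (hd : d ≠ 0) :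
    ∃ V : Finset K, V.card = Fintype.card F ^ d ∧ ∀ x, x ∈ V ↔ x ^ Fintype.card F ^ d = x := by
  classical
  obtain ⟨p, hp⟩ := CharP.exists F
  have := Fact.mk (CharP.char_is_prime F p)
  have := charP_of_injective_algebraMap (algebraMap F K).injective p
  have hdvd : p ∣ Fintype.card F ^ d := (CharP.cast_eq_zero_iff F p _).1 (by simp [hd])
  have h1 : 1 < Fintype.card F ^ d := Nat.one_lt_pow hd Fintype.one_lt_card
  have hsep : (X ^ Fintype.card F ^ d - X : K[X]).Separable := galois_poly_separable p _ hdvd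
  refine ⟨(X ^ Fintype.card F ^ d - X : K[X]).roots.toFinset, ?_, fun x => ?_⟩
  · rw [Multiset.toFinset_card_of_nodup (nodup_roots hsep),
      ← (IsAlgClosed.splits _).natDegree_eq_card_roots, FiniteField.X_pow_card_sub_X_natDegree_eq K h1]
  · rw [Multiset.mem_toFinset, mem_roots (FiniteField.X_pow_card_sub_X_ne_zero K h1)]
    simp [sub_eq_zero]

theorem finite_setOf_monic_natDegree_eq (F : Type*) [Field F] [Finite F] (N : ℕ) :
    {P : F[X] | P.Monic ∧ P.natDegree = N}.Finite := by
  classical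
  have := Fintype.ofFinite F
  refine Set.Finite.subset (Set.finite_range fun c : Fin (N + 1) → F =>
    ∑ i, C (c i) * X ^ (i : ℕ)) fun P hP => ⟨fun i => P.coeff i, ?_⟩
  conv_rhs => rw [P.as_sum_range_C_mul_X_pow, hP.2]
  rw [Finset.sum_range]

theorem card_pow_le_card_irreducible {F : Type*} [Field F] [Fintype F] {N : ℕ} (hN : N ≠ 0)
    (T : Finset F[X]) (hT : ∀ P, P ∈ T ↔ P.Monic ∧ Irreducible P ∧ P.natDegree = N) :
    Fintype.card F ^ N ≤ N * T.card + Fintype.card F ^ (N / 2 + 1) := by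
  classical
  let K := AlgebraicClosure F
  obtain ⟨S, hS, hS'⟩ := exists_finset_roots_of_irreducible K T fun P hP => (hT P).1 hP
  obtain ⟨V, hV, hV'⟩ := card_filter_pow_eq (F := F) (K := K) hN
  choose W hW hW' using fun d : ℕ => card_filter_pow_eq (F := F) (K := K) (d := d + 1) (by omega)
  have hsub : V ⊆ S ∪ (Finset.range (N / 2)).biUnion W := fun x hx => by
    rw [hV'] at hx
    have hα_int : IsIntegral F x := (Algebra.IsAlgebraic.isAlgebraic x).isIntegral
    have hirr := minpoly.irreducible hα_int
    have hdvd : (minpoly F x).natDegree ∣ N := by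
      refine hirr.natDegree_dvd_of_dvd_X_pow_card_pow_sub_X (minpoly.dvd F x ?_)
      rw [Nat.card_eq_fintype_card]
      simp [hx]
    have hx0 : (minpoly F x).eval₂ (algebraMap F K) x = 0 := minpoly.aeval F x
    rw [Finset.mem_union, Finset.mem_biUnion]
    by_cases h : (minpoly F x).natDegree = N
    · exact .inl ((hS' x).2 ⟨_, (hT _).2 ⟨minpoly.monic hα_int, hirr, h⟩, hx0⟩)
    · have hpos := hirr.natDegree_pos
      refine .inr ⟨(minpoly F x).natDegree - 1, ?_, ?_⟩
      · obtain ⟨r, hr⟩ := hdvd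
        have : 2 ≤ r := by
          rcases r with - | - | r
          · simp at hr; exact absurd hr hN
          · simp at hr; exact absurd hr.symm h
          · omega
        have : (minpoly F x).natDegree ≤ N / 2 := by
          rw [Nat.le_div_iff_mul_le two_pos]
          nlinarith
        rw [Finset.mem_range]
        omega
      · rw [hW', Nat.sub_add_cancel hpos]
        exact eval₂_eq_zero_pow_card_pow hirr hx0
  have hsum : ∑ d ∈ Finset.range (N / 2), (W d).card ≤ Fintype.card F ^ (N / 2 + 1) := by
    simp only [hW]
    have h2 : 2 ≤ Fintype.card F := Fintype.one_lt_card
    have := Nat.geomSum_lt (m := Fintype.card F) h2 (s := Finset.range (N / 2)) (n := N / 2)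
      fun k hk => Finset.mem_range.1 hk
    simp only [pow_succ, ← Finset.sum_mul]
    gcongr
  rw [← hV, ← hS]
  refine (Finset.card_le_card hsub).trans ((Finset.card_union_le _ _).trans ?_)
  gcongr
  exact Finset.card_biUnion_le.trans hsum

theorem card_hasseSymbol_fiber_le {F K : Type} [Field F] [Fintype F] [Field K] [Algebra F K]
    [IsAlgClosed K] {p e : ℕ} [Fact p.Prime] [Algebra (ZMod p) F] (hq : Fintype.card F = p ^ e)
    {n : RatFunc F} (h : TraceFiberBound K p e n) :
    ∃ C : ℕ, ∀ N ≥ 2, ∀ (b : ZMod p) (T : Finset F[X]),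
      (∀ P ∈ T, P.Monic ∧ Irreducible P ∧ P.natDegree = N ∧ ¬ P ∣ n.denom ∧
        hasseSymbol p P n = b) →
      p * (N * T.card) ≤ Fintype.card F ^ N + C * p ^ ((e * N + 1) / 2) := by
  obtain ⟨C, hC⟩ := h
  refine ⟨C, fun N hN b T hT => ?_⟩
  obtain ⟨S, hS, hS'⟩ := exists_finset_roots_of_irreducible K T
    fun P hP => ⟨(hT P hP).1, (hT P hP).2.1, (hT P hP).2.2.1⟩
  rw [← hS, hq, ← pow_mul]
  refine hC N hN (algebraMap F K (algebraMap (ZMod p) F b)) S fun x hx => ?_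
  obtain ⟨P, hP, hx⟩ := (hS' x).1 hx
  obtain ⟨h1, h2, rfl, h4, rfl⟩ := hT P hP
  refine ⟨?_, fun h0 => h4 ?_, (algebraMap_hasseSymbol hq h2 n hx).symm⟩
  · rw [pow_mul, ← hq]
    exact eval₂_eq_zero_pow_card_pow h2 hx
  · rw [minpoly.eq_of_irreducible_of_monic h2 hx h1]
    exact minpoly.dvd F x h0

theorem abs_card_sub_le_of_bounds {p N t : ℕ} {c Q D R : ℝ} (hp : 0 < p) (hN : 0 < N)
    (h : |(p * (N * t) : ℝ) - c * Q| ≤ p * D) (hD : D ≤ R) :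
    |(t : ℝ) - c / p * Q / N| ≤ R / N := by
  have hp' : (0 : ℝ) < p := by exact_mod_cast hp
  have hN' : (0 : ℝ) < N := by exact_mod_cast hN
  have : (t : ℝ) - c / p * Q / N = (p * (N * t) - c * Q) / (p * N) := by field_simp
  rw [this, abs_div, abs_of_pos (mul_pos hp' hN'), div_le_div_iff₀ (mul_pos hp' hN') hN']
  nlinarith [mul_le_mul_of_nonneg_left hD hp'.le]

theorem exists_card_hasseSymbol_bounds {F K : Type} [Field F] [Fintype F] [Field K] [Algebra F K]
    [IsAlgClosed K] {p e : ℕ} [Fact p.Prime] [Algebra (ZMod p) F] (hq : Fintype.card F = p ^ e)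
    {n : RatFunc F} (h : TraceFiberBound K p e n) :
    ∃ C : ℝ, ∀ N ≥ 2, n.denom.natDegree < N →
      |(Nat.card {P : F[X] // P.Monic ∧ Irreducible P ∧ P.natDegree = N ∧
          ¬ P ∣ n.denom ∧ hasseSymbol p P n = 0} : ℝ) -
        (1 / p) * (Fintype.card F : ℝ) ^ N / N| ≤
          C * (Fintype.card F : ℝ) ^ ((N : ℝ) / 2) / N ∧
      |(Nat.card {P : F[X] // P.Monic ∧ Irreducible P ∧ P.natDegree = N ∧
          ¬ P ∣ n.denom ∧ hasseSymbol p P n ≠ 0} : ℝ) -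
        ((p - 1 : ℝ) / p) * (Fintype.card F : ℝ) ^ N / N| ≤
          C * (Fintype.card F : ℝ) ^ ((N : ℝ) / 2) / N := by
  classical
  have hp := (Fact.out : p.Prime)
  obtain ⟨C, hC⟩ := card_hasseSymbol_fiber_le hq h
  refine ⟨Fintype.card F + C * p, fun N hN hdeg => ?_⟩
  let M : Finset F[X] := (finite_setOf_monic_natDegree_eq F N).toFinset.filter Irreducible
  have hM (P : F[X]) : P ∈ M ↔ P.Monic ∧ Irreducible P ∧ P.natDegree = N := by
    simp only [M, Finset.mem_filter, Set.Finite.mem_toFinset, Set.mem_ofPred_eq]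
    tauto
  have hdvd {P : F[X]} (hP : P.natDegree = N) : ¬ P ∣ n.denom := fun hd =>
    absurd (natDegree_le_of_dvd hd n.denom_ne_zero) (by omega)
  let t (b : ZMod p) : ℕ := (M.filter fun P => hasseSymbol p P n = b).card
  let s : ℕ := (M.filter fun P => ¬ hasseSymbol p P n = 0).card
  have ht1 : Nat.card {P : F[X] // P.Monic ∧ Irreducible P ∧ P.natDegree = N ∧
      ¬ P ∣ n.denom ∧ hasseSymbol p P n = 0} = t 0 := Nat.subtype_card _ fun P => by
    rw [Finset.mem_filter, hM]
    have := @hdvd P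
    tauto
  have hs1 : Nat.card {P : F[X] // P.Monic ∧ Irreducible P ∧ P.natDegree = N ∧
      ¬ P ∣ n.denom ∧ hasseSymbol p P n ≠ 0} = s := Nat.subtype_card _ fun P => by
    rw [Finset.mem_filter, hM]
    have := @hdvd P
    tauto
  rw [ht1, hs1]
  have htot : t 0 + s = M.card := Finset.card_filter_add_card_filter_not _
  set R := p ^ ((e * N + 1) / 2) with hR
  set q := Fintype.card F
  have htb (b : ZMod p) : p * (N * t b) ≤ q ^ N + C * R := hC N hN b _ fun P hP => by
    obtain ⟨hP1, hP2⟩ := Finset.mem_filter.1 hP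
    obtain ⟨h1, h2, h3⟩ := (hM P).1 hP1
    exact ⟨h1, h2, h3, hdvd h3, hP2⟩
  have hs : s = ∑ b ∈ Finset.univ.erase (0 : ZMod p), t b := by
    change (M.filter fun P => ¬ hasseSymbol p P n = 0).card = _
    rw [Finset.card_eq_sum_card_fiberwise (f := fun P => hasseSymbol p P n)
      (t := Finset.univ.erase (0 : ZMod p))]
    · refine Finset.sum_congr rfl fun b hb => ?_
      rw [Finset.filter_filter]
      congr 1
      refine Finset.filter_congr fun P _ => ⟨fun h => h.2, fun h => ⟨?_, h⟩⟩
      rw [h]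
      exact Finset.ne_of_mem_erase hb
    · intro P hP
      simpa using (Finset.mem_filter.1 hP).2
  have hsb : p * (N * s) ≤ (p - 1) * (q ^ N + C * R) := by
    rw [hs, Finset.mul_sum, Finset.mul_sum]
    refine (Finset.sum_le_sum fun b _ => htb b).trans ?_
    rw [Finset.sum_const, Finset.card_erase_of_mem (Finset.mem_univ _), Finset.card_univ, ZMod.card,
      smul_eq_mul]
  have hlow := card_pow_le_card_irreducible (by omega : N ≠ 0) M hM
  have hp0 : (0 : ℝ) < p := by exact_mod_cast hp.pos
  have htb' : (p * (N * t 0) : ℝ) ≤ q ^ N + C * R := by exact_mod_cast htb 0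
  have hsb' : (p * (N * s) : ℝ) ≤ (p - 1) * (q ^ N + C * R) := by
    have := (Nat.cast_le (α := ℝ)).2 hsb
    push_cast [hp.one_le] at this
    exact this
  have hlow' : (q : ℝ) ^ N ≤ N * (t 0 + s) + q ^ (N / 2 + 1) := by
    rw [← htot] at hlow
    exact_mod_cast hlow
  have hCR : (0 : ℝ) ≤ C * R := by positivity
  have hq1 : (1 : ℝ) ≤ q := by exact_mod_cast Fintype.card_pos (α := F)
  have hqN : (0 : ℝ) ≤ q ^ (N / 2 + 1) := by positivity
  have hp1 : (1 : ℝ) ≤ p := by exact_mod_cast hp.one_le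
  have hmain := mul_le_mul_of_nonneg_left hlow' hp0.le
  have hD : (q : ℝ) ^ (N / 2 + 1) + C * R ≤ (q + C * p) * (q : ℝ) ^ ((N : ℝ) / 2) := by
    have h1 : (q : ℝ) ^ (N / 2) ≤ (q : ℝ) ^ ((N : ℝ) / 2) := by
      rw [← Real.rpow_natCast]
      exact Real.rpow_le_rpow_of_exponent_le hq1 Nat.cast_div_le
    have h2 : (R : ℝ) ≤ p * (q : ℝ) ^ ((N : ℝ) / 2) := by
      have : (q : ℝ) ^ ((N : ℝ) / 2) = (p : ℝ) ^ (((e * N : ℕ) : ℝ) / 2) := by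
        rw [hq, Nat.cast_pow, ← Real.rpow_natCast, ← Real.rpow_mul hp0.le]
        push_cast
        ring_nf
      rw [this, hR, Nat.cast_pow, ← Real.rpow_natCast]
      nth_rw 2 [← Real.rpow_one (p : ℝ)]
      rw [← Real.rpow_add hp0]
      refine Real.rpow_le_rpow_of_exponent_le hp1 (Nat.cast_div_le.trans ?_)
      push_cast
      linarith
    rw [pow_succ]
    nlinarith [mul_le_mul_of_nonneg_right h1 (by positivity : (0 : ℝ) ≤ q),
      mul_le_mul_of_nonneg_left h2 (by positivity : (0 : ℝ) ≤ C)]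
  constructor
  · refine abs_card_sub_le_of_bounds hp.pos (by omega) ?_ hD
    rw [abs_le]
    constructor <;> nlinarith [mul_nonneg (sub_nonneg.2 hp1) hCR, mul_nonneg hp0.le hqN]
  · refine abs_card_sub_le_of_bounds hp.pos (by omega) ?_ hD
    rw [abs_le]
    constructor <;> nlinarith [mul_nonneg (sub_nonneg.2 hp1) hCR, mul_nonneg hp0.le hqN]

theorem algEquiv_ext_of_adjoin_eq_top {k E : Type*} [Field k] [Field E] [Algebra k E] {α : E}
    (hgen : Algebra.adjoin k {α} = ⊤) {τ τ' : E ≃ₐ[k] E} (h : τ α = τ' α) : τ = τ' := by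
  have : (τ : E →ₐ[k] E) = τ' := AlgHom.ext_of_adjoin_eq_top hgen fun x hx => by
    rw [Set.mem_singleton_iff.1 hx]
    exact h
  ext x
  exact DFunLike.congr_fun this x

theorem exists_algEquiv_apply_eq_add_one {k E : Type*} [Field k] [Field E] [Algebra k E] {p : ℕ}
    [Fact p.Prime] [CharP E p] {α : E} {n : k} (hα : α ^ p - α = algebraMap k E n)
    (hgen : Algebra.adjoin k {α} = ⊤) (hdeg : Module.finrank k E = p) :
    ∃ τ : E ≃ₐ[k] E, τ α = α + 1 := by
  have hp := (Fact.out : p.Prime)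
  have : FiniteDimensional k E := Module.finite_of_finrank_pos (hdeg ▸ hp.pos)
  have hα_int : IsIntegral k α := Algebra.IsIntegral.isIntegral α
  let pb := PowerBasis.ofAdjoinEqTop hα_int hgen
  have hgen' : pb.gen = α := PowerBasis.ofAdjoinEqTop_gen hα_int hgen
  have hlt : (X + C n : k[X]).degree < p := by
    rw [degree_X_add_C]; exact_mod_cast hp.one_lt
  have hmonic : (X ^ p - (X + C n) : k[X]).Monic := monic_X_pow_sub hlt
  have hnat : (X ^ p - (X + C n) : k[X]).natDegree = p :=
    natDegree_eq_of_degree_eq_some (by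
      rw [degree_sub_eq_left_of_degree_lt (by rwa [degree_X_pow]), degree_X_pow])
  have hmin : minpoly k pb.gen = X ^ p - (X + C n) := by
    refine (eq_of_monic_of_dvd_of_natDegree_le (minpoly.monic (hgen' ▸ hα_int)) hmonic
      (minpoly.dvd k _ ?_) ?_).symm
    · rw [hgen']; simp [← hα]
    · rw [hnat, pb.natDegree_minpoly, ← pb.finrank, hdeg]
  have hroot : aeval (α + 1) (minpoly k pb.gen) = 0 := by
    rw [hmin]
    simp only [map_sub, map_add, map_pow, aeval_X, aeval_C, ← hα, add_pow_char, one_pow]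
    ring
  let ψ : E →ₐ[k] E := pb.lift (α + 1) hroot
  refine ⟨AlgEquiv.ofBijective ψ ψ.bijective, ?_⟩
  have := pb.lift_gen (α + 1) hroot
  rwa [hgen'] at this

theorem ne_artinSchreier_add_C_of_geometric {F E : Type*} [Field F] [Field E]
    [Algebra (RatFunc F) E] [Algebra F E] [IsScalarTower F (RatFunc F) E] {p : ℕ} [Fact p.Prime]
    [CharP E p] {α : E} {n : RatFunc F} (hα : α ^ p - α = algebraMap (RatFunc F) E n)
    (hgen : Algebra.adjoin (RatFunc F) {α} = ⊤) (hdeg : Module.finrank (RatFunc F) E = p)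
    (hgeo : ∀ x : E, IsAlgebraic F x → ∃ c : F, algebraMap F E c = x) (g : RatFunc F) (c : F) :
    n ≠ g ^ p - g + RatFunc.C c := by
  rintro rfl
  have hp := (Fact.out : p.Prime)
  have hc (c : F) : algebraMap (RatFunc F) E (RatFunc.C c) = algebraMap F E c := by
    rw [IsScalarTower.algebraMap_apply F (RatFunc F) E, RatFunc.algebraMap_eq_C]
  set β := α - algebraMap (RatFunc F) E g with hβ
  have hβ1 : β ^ p - β = algebraMap F E c := by
    rw [map_add, map_sub, map_pow, hc] at hα
    rw [hβ, sub_pow_char]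
    linear_combination hα
  obtain ⟨c', hc'⟩ := hgeo β ⟨X ^ p - (X + C c), (monic_X_pow_sub (by
    rw [degree_X_add_C]; exact_mod_cast hp.one_lt)).ne_zero, by simp [← hβ1]⟩
  have hα' : α = algebraMap (RatFunc F) E (g + RatFunc.C c') := by
    rw [map_add, hc, hc', hβ]; ring
  rw [hα', Algebra.adjoin_singleton_algebraMap, Subalgebra.bot_eq_top_iff_finrank_eq_one,
    hdeg] at hgen
  exact hp.one_lt.ne' hgen

/-- **Chebotarev counts in a geometric Artin–Schreier extension (proof of Lemma 3.2).**
Let `q` be a power of a prime `p`, `k = F_q(t)`, and `E = k(α)` a geometric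
Artin–Schreier extension of `k` of degree `p`, where `α^p − α = n` for some `n ∈ k`, with
Galois group generated by `σ`.  Let `Sk` be the set of monic irreducible polynomials
unramified in `E` (in particular every monic irreducible `P` with `ord_P(n) ≥ 0` lies in
`Sk`) and let `Art P = (P, E/k)` be the Artin symbol at `P ∈ Sk`, characterized by
`(P, E/k)(α) = α + {n/P}`.  Then for all sufficiently large `N`:
`T₁ = {P monic irreducible : deg P = N, ord_P(n) ≥ 0, {n/P} = 0}` equals
`{P ∈ Sk : deg P = N, (P,E/k) = id}` and `#T₁ = (1/p)·q^N/N + O(q^{N/2}/N)`; and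
`T₂ = {P monic irreducible : deg P = N, ord_P(n) ≥ 0, {n/P} ≠ 0}` equals
`{P ∈ Sk : deg P = N, (P,E/k) = σ^i for some i with p ∤ i}` and
`#T₂ = ((p−1)/p)·q^N/N + O(q^{N/2}/N)`. -/
theorem artinSchreier_chebotarev_counts
    (p e : ℕ) (hp : p.Prime) (he : 0 < e)
    (Fq : Type) [Field Fq] [Fintype Fq] (hq : Fintype.card Fq = p ^ e)
    [Algebra (ZMod p) Fq]
    (n : RatFunc Fq) (hn : n ≠ 0)
    -- `E = k(α)` with `α^p − α = n`, a geometric cyclic extension of `k` of degree `p`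
    (E : Type) [Field E] [Algebra (RatFunc Fq) E] [Algebra Fq E]
    [IsScalarTower Fq (RatFunc Fq) E]
    (α : E)
    (hα : α ^ p - α = algebraMap (RatFunc Fq) E n)
    (hgen : Algebra.adjoin (RatFunc Fq) ({α} : Set E) = ⊤)
    (hdeg : Module.finrank (RatFunc Fq) E = p)
    (hgeo : ∀ x : E, IsAlgebraic Fq x → ∃ c : Fq, algebraMap Fq E c = x)
    -- `σ` generates the Galois group `Gal(E/k)`
    (σ : E ≃ₐ[RatFunc Fq] E)
    (hσ : ∀ τ : E ≃ₐ[RatFunc Fq] E, ∃ i : ℕ, τ = σ ^ i)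
    -- `Sk`: the set of monic irreducible polynomials unramified in `E`
    (Sk : Set (Polynomial Fq))
    (hSk : ∀ P ∈ Sk, P.Monic ∧ Irreducible P)
    (hSk' : ∀ P : Polynomial Fq, P.Monic → Irreducible P → ¬ P ∣ n.denom → P ∈ Sk)
    -- the Artin symbol `(P, E/k)` at unramified `P`, acting on `α` by adding `{n/P}`
    (Art : Polynomial Fq → (E ≃ₐ[RatFunc Fq] E))
    (hArt : ∀ P ∈ Sk, ¬ P ∣ n.denom →
      Art P α = α + algebraMap Fq E (algebraMap (ZMod p) Fq (hasseSymbol p P n))) :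
    ∃ C : ℝ, ∀ᶠ N : ℕ in atTop,
      ({P : Polynomial Fq | P.Monic ∧ Irreducible P ∧ P.natDegree = N ∧
          ¬ P ∣ n.denom ∧ hasseSymbol p P n = 0}
        = {P : Polynomial Fq | P ∈ Sk ∧ P.natDegree = N ∧ Art P = 1}) ∧
      |(Nat.card {P : Polynomial Fq // P.Monic ∧ Irreducible P ∧ P.natDegree = N ∧
          ¬ P ∣ n.denom ∧ hasseSymbol p P n = 0} : ℝ) -
        (1 / p) * (Fintype.card Fq : ℝ) ^ N / N| ≤
          C * (Fintype.card Fq : ℝ) ^ ((N : ℝ) / 2) / N ∧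
      ({P : Polynomial Fq | P.Monic ∧ Irreducible P ∧ P.natDegree = N ∧
          ¬ P ∣ n.denom ∧ hasseSymbol p P n ≠ 0}
        = {P : Polynomial Fq | P ∈ Sk ∧ P.natDegree = N ∧
            ∃ i : ℕ, ¬ p ∣ i ∧ Art P = σ ^ i}) ∧
      |(Nat.card {P : Polynomial Fq // P.Monic ∧ Irreducible P ∧ P.natDegree = N ∧
          ¬ P ∣ n.denom ∧ hasseSymbol p P n ≠ 0} : ℝ) -
        ((p - 1 : ℝ) / p) * (Fintype.card Fq : ℝ) ^ N / N| ≤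
          C * (Fintype.card Fq : ℝ) ^ ((N : ℝ) / 2) / N := by
  have := Fact.mk hp
  have : CharP Fq p := charP_of_injective_algebraMap (algebraMap (ZMod p) Fq).injective p
  have : CharP E p := charP_of_injective_algebraMap (algebraMap Fq E).injective p
  have : CharP (AlgebraicClosure Fq) p :=
    charP_of_injective_algebraMap (algebraMap Fq (AlgebraicClosure Fq)).injective p
  have hbound : TraceFiberBound (AlgebraicClosure Fq) p e n := by
    refine (traceFiberBound_or_eq_artinSchreier hq he n).resolve_right ?_
    rintro ⟨g, c, h⟩
    exact ne_artinSchreier_add_C_of_geometric hα hgen hdeg hgeo g c h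
  have hσp : σ ^ p = 1 := by
    have hd : (σ α - α) ^ p = σ α - α := by
      have h1 := congrArg σ hα
      rw [map_sub, map_pow, AlgEquiv.commutes] at h1
      rw [sub_pow_char]
      linear_combination h1 - hα
    obtain ⟨c, hc⟩ := hgeo (σ α - α) ⟨X ^ p - X, FiniteField.X_pow_card_sub_X_ne_zero Fq hp.one_lt,
      by simp [hd]⟩
    have hσc : σ (algebraMap Fq E c) = algebraMap Fq E c := by
      rw [IsScalarTower.algebraMap_apply Fq (RatFunc Fq) E, AlgEquiv.commutes]
    have hpow (m : ℕ) : (σ ^ m) α = α + m * algebraMap Fq E c := by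
      induction m with
      | zero => simp
      | succ m ih =>
        rw [pow_succ', AlgEquiv.mul_apply, ih, map_add, map_mul, map_natCast, hσc, hc]
        push_cast
        ring
    refine algEquiv_ext_of_adjoin_eq_top hgen ?_
    rw [hpow, CharP.cast_eq_zero, zero_mul, add_zero, AlgEquiv.one_apply]
  have hσ1 : σ ≠ 1 := by
    rintro rfl
    obtain ⟨τ, hτ⟩ := exists_algEquiv_apply_eq_add_one hα hgen hdeg
    obtain ⟨i, rfl⟩ := hσ τ
    simp at hτ
  have hcop {i : ℕ} (hi : ¬ p ∣ i) (h : σ ^ i = 1) : False := by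
    refine hσ1 (orderOf_eq_one_iff.1 (Nat.dvd_one.1 ?_))
    rw [← (hp.coprime_iff_not_dvd.2 hi)]
    exact Nat.dvd_gcd (orderOf_dvd_of_pow_eq_one hσp) (orderOf_dvd_of_pow_eq_one h)
  have hart {P : Fq[X]} (hP : P ∈ Sk) (hd : ¬ P ∣ n.denom) :
      hasseSymbol p P n = 0 ↔ Art P = 1 := by
    have h := hArt P hP hd
    constructor
    · intro h0
      refine algEquiv_ext_of_adjoin_eq_top hgen ?_
      rw [h, h0, map_zero, map_zero, add_zero, AlgEquiv.one_apply]
    · intro h1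
      simpa [h1] using h
  obtain ⟨C, hC⟩ := exists_card_hasseSymbol_bounds hq hbound
  refine ⟨C, ?_⟩
  filter_upwards [eventually_ge_atTop 2, eventually_gt_atTop n.denom.natDegree] with N hN hdegN
  have hdvd {P : Fq[X]} (hP : P.natDegree = N) : ¬ P ∣ n.denom := fun hd =>
    absurd (natDegree_le_of_dvd hd n.denom_ne_zero) (by omega)
  obtain ⟨h1, h2⟩ := hC N hN hdegN
  refine ⟨?_, h1, ?_, h2⟩
  · ext P
    constructor
    · rintro ⟨hm, hi, hP, hd, h0⟩
      have hS := hSk' P hm hi hd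
      exact ⟨hS, hP, (hart hS hd).1 h0⟩
    · rintro ⟨hS, hP, h0⟩
      exact ⟨(hSk P hS).1, (hSk P hS).2, hP, hdvd hP, (hart hS (hdvd hP)).2 h0⟩
  · ext P
    constructor
    · rintro ⟨hm, hi, hP, hd, h0⟩
      have hS := hSk' P hm hi hd
      obtain ⟨i, hi⟩ := hσ (Art P)
      refine ⟨hS, hP, i, ?_, hi⟩
      rintro ⟨j, rfl⟩
      exact h0 ((hart hS hd).2 (by rw [hi, pow_mul, hσp, one_pow]))
    · rintro ⟨hS, hP, i, hi, h0⟩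
      exact ⟨(hSk P hS).1, (hSk P hS).2, hP, hdvd hP,
        fun h => hcop hi (h0.symm.trans ((hart hS (hdvd hP)).1 h))⟩
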